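/- arXiv:2212.06487 — 2 statements merged into one kernel-verified Lean document; each statement's English description precedes it below -/
import Mathlib

section
/- Let d ≥ 4 and let f₁, f₂ ∈ Ḣ^{(d−4)/4}(ℝ^d). Set u_j(t) = e^{itΔ²}f_j for j = 1, 2. Then there is a constant C (independent of f₁, f₂) such that ‖u₁ u₂‖_{L²_{t,x}(ℝ×ℝ^d)} ≤ C ‖f₁‖_{Ḣ^{(d−4)/4}(ℝ^d)} ‖f₂‖_{Ḣ^{(d−4)/4}(ℝ^d)}. -/
open MeasureTheory Set
open scoped RealInnerProductSpace ENNReal NNReal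

noncomputable section

/-- Spatial Fourier transform on ℝ^d, convention `f̂(ξ) = ∫ e^{-i x·ξ} f(x) dx`. -/
def ftd {d : ℕ} (f : EuclideanSpace ℝ (Fin d) → ℂ) (ξ : EuclideanSpace ℝ (Fin d)) : ℂ :=
  ∫ x : EuclideanSpace ℝ (Fin d), Complex.exp (-Complex.I * ((⟪x, ξ⟫ : ℝ) : ℂ)) * f x

/-- Inverse Fourier transform on ℝ^d. -/
def invFtd {d : ℕ} (g : EuclideanSpace ℝ (Fin d) → ℂ) (x : EuclideanSpace ℝ (Fin d)) : ℂ :=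
  (((2 * Real.pi) ^ d)⁻¹ : ℝ) •
    ∫ ξ : EuclideanSpace ℝ (Fin d), Complex.exp (Complex.I * ((⟪x, ξ⟫ : ℝ) : ℂ)) * g ξ

/-- Biharmonic Schrödinger propagator `e^{itΔ²}` on ℝ^d, the Fourier multiplier with
symbol `e^{-it|ξ|⁴}`. -/
def bpropd {d : ℕ} (t : ℝ) (φ : EuclideanSpace ℝ (Fin d) → ℂ) :
    EuclideanSpace ℝ (Fin d) → ℂ :=
  invFtd fun ξ => Complex.exp (-Complex.I * (t : ℂ) * ((‖ξ‖ ^ 4 : ℝ) : ℂ)) * ftd φ ξ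

/-- Homogeneous Sobolev norm `‖f‖_{Ḣ^s(ℝ^d)} = ‖|ξ|^s f̂‖_{L²}`. -/
def HsHomNormd {d : ℕ} (s : ℝ) (f : EuclideanSpace ℝ (Fin d) → ℂ) : ℝ≥0∞ :=
  (∫⁻ ξ : EuclideanSpace ℝ (Fin d),
    ENNReal.ofReal (‖ξ‖ ^ (2 * s) * ‖ftd f ξ‖ ^ 2)) ^ (1/2 : ℝ)

/-- `L²_{t,x}(ℝ × ℝ^d)` norm of a space-time function. -/
def L2txNorm {d : ℕ} (F : ℝ → EuclideanSpace ℝ (Fin d) → ℂ) : ℝ≥0∞ :=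
  (∫⁻ p : ℝ × EuclideanSpace ℝ (Fin d), ENNReal.ofReal (‖F p.1 p.2‖ ^ 2)) ^ (1/2 : ℝ)

lemma L2 {d : ℕ} (F : EuclideanSpace ℝ (Fin d) → ℝ≥0∞) (hF : Measurable F) (hd : 1 ≤ d) :
    ∫⁻ v, F v ≤ 2 * ∫⁻ w, (∫⁻ r in Ioi (0:ℝ), ENNReal.ofReal (r ^ (d - 1)) *
      ({w : EuclideanSpace ℝ (Fin d) | 1 ≤ ‖w‖ ∧ ‖w‖ ≤ 2}.indicator 1 w * F (r • w))) := by
  have hA : MeasurableSet {w : EuclideanSpace ℝ (Fin d) | 1 ≤ ‖w‖ ∧ ‖w‖ ≤ 2} :=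
    (measurableSet_le measurable_const measurable_norm).inter
      (measurableSet_le measurable_norm measurable_const)
  set A : Set (EuclideanSpace ℝ (Fin d)) := {w | 1 ≤ ‖w‖ ∧ ‖w‖ ≤ 2} with hAdef
  have hind : Measurable (A.indicator (1 : EuclideanSpace ℝ (Fin d) → ℝ≥0∞)) :=
    measurable_one.indicator hA
  have : Nonempty (Fin d) := ⟨⟨0, by omega⟩⟩
  have h0 : ∀ᵐ v : EuclideanSpace ℝ (Fin d), v ≠ 0 := by
    simp [ae_iff]
  -- key: inner
  have key : ∀ᵐ v : EuclideanSpace ℝ (Fin d), F v ≤ 2 * ∫⁻ r in Ioi (0:ℝ),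
      ENNReal.ofReal r⁻¹ * (A.indicator 1 (r⁻¹ • v) * F v) := by
    filter_upwards [h0] with v hv
    have hn : 0 < ‖v‖ := norm_pos_iff.2 hv
    have : ∫⁻ r in Icc (‖v‖/2) ‖v‖, ENNReal.ofReal ‖v‖⁻¹ * F v ≤ ∫⁻ r in Ioi (0:ℝ),
      ENNReal.ofReal r⁻¹ * (A.indicator 1 (r⁻¹ • v) * F v) := by
      calc _ ≤ ∫⁻ r in Icc (‖v‖/2) ‖v‖, ENNReal.ofReal r⁻¹ * (A.indicator 1 (r⁻¹ • v) * F v) := by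
            apply setLIntegral_mono' measurableSet_Icc
            intro r hr
            have hr0 : 0 < r := by linarith [hr.1]
            have hm : r⁻¹ • v ∈ A := by
              simp only [hAdef, mem_ofPred_eq, norm_smul, norm_inv, Real.norm_eq_abs, abs_of_pos hr0]
              rw [inv_mul_eq_div, le_div_iff₀ hr0, div_le_iff₀ hr0]
              constructor <;> linarith [hr.1, hr.2]
            rw [indicator_of_mem hm]
            simp only [Pi.one_apply, one_mul]
            gcongr
            exact hr.2
        _ ≤ _ := lintegral_mono_set (fun r hr => by
            have := hr.1
            simp only [mem_Ioi]; linarith)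
    rw [setLIntegral_const, Real.volume_Icc] at this
    calc F v = 2 * (ENNReal.ofReal ‖v‖⁻¹ * F v * ENNReal.ofReal (‖v‖ - ‖v‖ / 2)) := by
          have h2 : ∀ x : ℝ≥0∞, 2 * x = ENNReal.ofReal 2 * x := by simp
          rw [h2, mul_right_comm, ← mul_assoc, ← ENNReal.ofReal_mul (by positivity), ← ENNReal.ofReal_mul (by positivity)]
          have : 2 * (‖v‖⁻¹ * (‖v‖ - ‖v‖/2)) = 1 := by field_simp; ring
          rw [this]; simp
      _ ≤ _ := by gcongr
  calc ∫⁻ v, F v ≤ ∫⁻ v, 2 * ∫⁻ r in Ioi (0:ℝ),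
      ENNReal.ofReal r⁻¹ * (A.indicator 1 (r⁻¹ • v) * F v) := lintegral_mono_ae key
    _ = 2 * ∫⁻ v, ∫⁻ r in Ioi (0:ℝ),
      ENNReal.ofReal r⁻¹ * (A.indicator 1 (r⁻¹ • v) * F v) := by
        rw [lintegral_const_mul' _ _ (by simp)]
    _ = 2 * ∫⁻ r in Ioi (0:ℝ), ∫⁻ v,
      ENNReal.ofReal r⁻¹ * (A.indicator 1 (r⁻¹ • v) * F v) := by
        rw [lintegral_lintegral_swap]
        apply Measurable.aemeasurable
        apply Measurable.mul (by fun_prop)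
        apply Measurable.mul _ (by fun_prop)
        exact hind.comp (by fun_prop)
    _ = 2 * ∫⁻ r in Ioi (0:ℝ), ∫⁻ w, ENNReal.ofReal (r ^ (d - 1)) *
      (A.indicator 1 w * F (r • w)) := by
        congr 1
        apply setLIntegral_congr_fun measurableSet_Ioi
        intro r hr
        have hr : 0 < r := hr
        have e := Measure.map_addHaar_smul (volume : Measure (EuclideanSpace ℝ (Fin d))) hr.ne'
        have hmeas : Measurable fun v => ENNReal.ofReal r⁻¹ * (A.indicator 1 (r⁻¹ • v) * F v) := by
          apply Measurable.mul (by fun_prop)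
          apply Measurable.mul _ (by fun_prop)
          exact hind.comp (by fun_prop)
        have e2 : ∫⁻ w, ENNReal.ofReal r⁻¹ * (A.indicator 1 w * F (r • w)) = 
           ENNReal.ofReal |(r ^ d)⁻¹| * ∫⁻ v, ENNReal.ofReal r⁻¹ * (A.indicator 1 (r⁻¹ • v) * F v) := by
          rw [finrank_euclideanSpace_fin] at e
          rw [← smul_eq_mul, ← lintegral_smul_measure, ← e, lintegral_map hmeas (by fun_prop)]
          simp [smul_smul, hr.ne']
        have e3 : ENNReal.ofReal (r^d) * ENNReal.ofReal |(r ^ d)⁻¹| = 1 := by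
          rw [← ENNReal.ofReal_mul (by positivity), abs_of_pos (by positivity), mul_inv_cancel₀ (by positivity)]
          simp
        calc _ = ENNReal.ofReal (r^d) * ∫⁻ w, ENNReal.ofReal r⁻¹ * (A.indicator 1 w * F (r • w)) := by
              rw [e2, ← mul_assoc, e3, one_mul]
          _ = _ := by
            rw [← lintegral_const_mul' _ _ (by simp)]
            apply lintegral_congr
            intro w
            rw [← mul_assoc, ← ENNReal.ofReal_mul (by positivity)]
            congr 2
            obtain ⟨k, rfl⟩ := Nat.exists_eq_add_of_le hd
            rw [Nat.add_sub_cancel_left, add_comm, pow_succ]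
            field_simp
    _ = _ := by
        rw [lintegral_lintegral_swap]
        apply Measurable.aemeasurable
        apply Measurable.mul (by fun_prop)
        apply Measurable.mul _ (by fun_prop)
        exact hind.comp (by fun_prop)

lemma L1 (d : ℕ) (hd : 4 ≤ d) (a : ℝ) (ha : 0 ≤ a) (ha' : a < d - 1) :
    ∃ J : ℝ≥0∞, J < ⊤ ∧ ∀ e : EuclideanSpace ℝ (Fin d), ‖e‖ = 1 →
      ∫⁻ w, {w : EuclideanSpace ℝ (Fin d) | 1 ≤ ‖w‖ ∧ ‖w‖ ≤ 2}.indicator 1 w *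
        (ENNReal.ofReal (‖w‖ ^ 2 - ⟪e, w⟫ ^ 2)) ^ (-a / 2) ≤ J := by
  classical
  set i0 : Fin d := ⟨0, by omega⟩ with hi0
  set b : ℝ := a / (d - 1) with hb
  have hd1 : (0:ℝ) < d - 1 := by
    have : (4:ℝ) ≤ d := by exact_mod_cast hd
    linarith
  have hb0 : 0 ≤ b := by positivity
  have hb1 : b < 1 := by rw [hb, div_lt_one hd1]; exact ha'
  set h : Fin d → ℝ → ℝ := fun i t => (Icc (-2:ℝ) 2).indicator (fun t => if i = i0 then 1 else |t| ^ (-b)) t with hh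
  have hint : ∀ i, Integrable (h i) volume := by
    intro i
    rw [hh]
    simp only
    rw [integrable_indicator_iff measurableSet_Icc]
    by_cases hi : i = i0
    · simp [hi]
    · simp only [hi, if_false]
      have h1 : IntervalIntegrable (fun t : ℝ => |t| ^ (-b)) volume 0 2 := by
        have := intervalIntegral.intervalIntegrable_rpow' (a := 0) (b := 2) (r := -b) (by linarith)
        refine this.congr ?_
        intro t ht
        rw [uIoc_of_le (by norm_num)] at ht
        simp only
        rw [abs_of_pos ht.1]
      have h2 : IntervalIntegrable (fun t : ℝ => |t| ^ (-b)) volume (-2) 0 := by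
        have := (IntervalIntegrable.iff_comp_neg (f := fun t : ℝ => |t| ^ (-b))).1 h1
        simpa using this.symm
      have := h2.trans h1
      rw [intervalIntegrable_iff_integrableOn_Icc_of_le (by norm_num)] at this
      exact this
  have hprod : Integrable (fun x : Fin d → ℝ => ∏ i, h i (x i)) volume := Integrable.fintype_prod hint
  have hnn : ∀ i t, 0 ≤ h i t := by
    intro i t
    rw [hh]
    apply indicator_nonneg
    intro t _
    split_ifs <;> positivity
  refine ⟨∫⁻ x : Fin d → ℝ, ENNReal.ofReal (∏ i, h i (x i)), ?_, ?_⟩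
  · have := hprod.2
    rw [hasFiniteIntegral_iff_ofReal] at this
    · exact this
    · exact Filter.Eventually.of_forall fun x => Finset.prod_nonneg fun i _ => hnn i _
  intro e he
  obtain ⟨B, hB⟩ := Orthonormal.exists_orthonormalBasis_extension_of_card_eq
    (𝕜 := ℝ) (E := EuclideanSpace ℝ (Fin d)) (ι := Fin d) (by simp) (v := fun _ => e) (s := {i0}) (by
      rw [orthonormal_iff_ite]
      rintro ⟨i, hi⟩ ⟨j, hj⟩
      rw [mem_singleton_iff] at hi hj
      subst hi; subst hj
      simp [Set.domRestrict, he])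
  have hBe : B i0 = e := hB i0 rfl
  have hmp : MeasurePreserving (fun w => WithLp.ofLp (B.repr w)) (volume : Measure (EuclideanSpace ℝ (Fin d))) volume :=
    (PiLp.volume_preserving_ofLp (Fin d)).comp B.measurePreserving_repr
  have hmeas : Measurable fun x : Fin d → ℝ => ENNReal.ofReal (∏ i, h i (x i)) := by
    apply ENNReal.measurable_ofReal.comp
    apply Finset.measurable_prod
    intro i _
    have : Measurable (h i) := by
      apply Measurable.indicator _ measurableSet_Icc
      split_ifs <;> fun_prop
    exact this.comp (measurable_pi_apply i)
  rw [← hmp.lintegral_comp hmeas]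
  have hae : ∀ᵐ w : EuclideanSpace ℝ (Fin d), ∀ i, B.repr w i ≠ 0 := by
    rw [ae_all_iff]
    intro i
    exact hmp.quasiMeasurePreserving.ae (Measure.ae_eval_ne (fun _ => volume) i (0:ℝ))
  apply lintegral_mono_ae
  filter_upwards [hae] with w hw
  by_cases hm : 1 ≤ ‖w‖ ∧ ‖w‖ ≤ 2
  swap
  · rw [indicator_of_notMem (by exact hm)]; simp
  rw [indicator_of_mem (by exact hm)]
  simp only [Pi.one_apply, one_mul]
  set x := B.repr w with hx
  have hsum : ‖w‖ ^ 2 = ∑ i, (x i) ^ 2 := by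
    rw [← B.repr.norm_map w, EuclideanSpace.norm_sq_eq]
    simp [hx]
  have hin : ⟪e, w⟫ = x i0 := by rw [hx, B.repr_apply_apply, hBe]
  set S := ‖w‖ ^ 2 - ⟪e, w⟫ ^ 2 with hS
  have hS' : S = ∑ i ∈ Finset.univ.erase i0, (x i)^2 := by
    rw [hS, hsum, hin, ← Finset.add_sum_erase _ _ (Finset.mem_univ i0)]; ring
  have hle : ∀ i ∈ Finset.univ.erase i0, (x i)^2 ≤ S := by
    intro i hi
    rw [hS']
    exact Finset.single_le_sum (f := fun i => (x i)^2) (fun j _ => sq_nonneg _) hi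
  have hxb : ∀ i, x i ∈ Icc (-2:ℝ) 2 := by
    intro i
    have : (x i)^2 ≤ ‖w‖^2 := by
      rw [hsum]; exact Finset.single_le_sum (f := fun i => (x i)^2) (fun j _ => sq_nonneg _) (Finset.mem_univ i)
    have := abs_le_of_sq_le_sq' this (norm_nonneg _)
    constructor <;> linarith [this.1, this.2, hm.2]
  have hcard : ((Finset.univ.erase i0).card : ℝ) = d - 1 := by
    rw [Finset.card_erase_of_mem (Finset.mem_univ _), Finset.card_univ, Fintype.card_fin,
      Nat.cast_sub (by omega)]; simp
  have hSpos : 0 < S := by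
    have : (⟨1, by omega⟩ : Fin d) ∈ Finset.univ.erase i0 := by simp [hi0]
    have h2 := hle _ this
    have h3 := hw ⟨1, by omega⟩
    have : 0 < (x ⟨1, by omega⟩)^2 := by positivity
    linarith
  rw [ENNReal.ofReal_rpow_of_pos hSpos]
  apply ENNReal.ofReal_le_ofReal
  have hprodeq : ∏ i, h i (x i) = ∏ i ∈ Finset.univ.erase i0, |x i| ^ (-b) := by
    rw [← Finset.mul_prod_erase _ _ (Finset.mem_univ i0)]
    have : h i0 (x i0) = 1 := by simp only [hh]; rw [indicator_of_mem (hxb i0)]; simp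
    rw [this, one_mul]
    apply Finset.prod_congr rfl
    intro i hi
    simp only [hh]; rw [indicator_of_mem (hxb i)]
    simp [Finset.ne_of_mem_erase hi]
  rw [hprodeq]
  calc S ^ (-a/2) = ∏ i ∈ Finset.univ.erase i0, S ^ (-b/2) := by
        rw [Finset.prod_const, ← Real.rpow_natCast, ← Real.rpow_mul hSpos.le, hcard, hb]
        congr 1
        field_simp
    _ ≤ _ := by
        apply Finset.prod_le_prod
        · intro i _; positivity
        intro i hi
        have hxi : 0 < |x i| := abs_pos.2 (hw i)
        calc S ^ (-b/2) ≤ (|x i|^2) ^ (-b/2) := by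
              apply Real.rpow_le_rpow_of_nonpos (by positivity)
              · rw [sq_abs]; exact hle i hi
              · linarith
          _ = _ := by
              rw [← Real.rpow_natCast, ← Real.rpow_mul hxi.le]
              congr 1
              push_cast; ring

lemma enn_anti {x y : ℝ≥0∞} {p : ℝ} (h : x ≤ y) (hp : p ≤ 0) : y ^ p ≤ x ^ p := by
  obtain ⟨q, rfl⟩ : ∃ q, p = -q := ⟨-p, by ring⟩
  rw [ENNReal.rpow_neg, ENNReal.rpow_neg]
  apply ENNReal.inv_le_inv.2
  exact ENNReal.rpow_le_rpow h (by linarith)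

lemma geom_ineq {d : ℕ} (z w e : EuclideanSpace ℝ (Fin d)) (r : ℝ) (he : ‖e‖ = 1)
    (hz : z = ‖z‖ • e) (hw : 1 ≤ ‖w‖) :
    r ^ 4 * (‖w‖ ^ 2 - ⟪e, w⟫ ^ 2) ≤ ‖(1/2 : ℝ) • z + r • w‖ ^ 2 * ‖(1/2 : ℝ) • z - r • w‖ ^ 2 := by
  have hzw : ⟪z, w⟫ = ‖z‖ * ⟪e, w⟫ := by
    conv_lhs => rw [hz]
    rw [real_inner_smul_left]
  rw [norm_add_sq_real, norm_sub_sq_real, norm_smul, norm_smul, real_inner_smul_left,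
    real_inner_smul_right, hzw]
  have hc : ⟪e, w⟫ ^ 2 ≤ ‖w‖ ^ 2 := by
    have := abs_real_inner_le_norm e w
    rw [he, one_mul] at this
    exact sq_le_sq' (by linarith [abs_le.1 this]) (abs_le.1 this).2
  set c := ⟪e, w⟫
  set n := ‖w‖
  set m := ‖z‖
  have hr : ‖r‖ ^ 2 = r ^ 2 := by simp
  have e1 : ((‖(1/2:ℝ)‖ * m) ^ 2 + 2 * (1/2 * (r * (m * c))) + (‖r‖ * n) ^ 2) *
     ((‖(1/2:ℝ)‖ * m) ^ 2 - 2 * (1/2 * (r * (m * c))) + (‖r‖ * n) ^ 2) =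
     (m^2/4 + r^2 * n^2)^2 - r^2 * m^2 * c^2 := by
    simp only [mul_pow, hr]
    norm_num
    ring
  rw [e1]
  have hn : 1 ≤ n ^ 2 := one_le_pow₀ hw
  have hs : 0 ≤ n^2 - c^2 := by linarith
  -- (m²/4 + r²n²)² - r²m²c² 
  have e2 : (m^2/4 + r^2 * n^2)^2 - r^2 * m^2 * c^2 = (m^2/4 - r^2*n^2)^2 + r^2*m^2*(n^2-c^2) := by ring
  have e3 : (m^2/4 + r^2 * n^2)^2 - r^2 * m^2 * c^2 - r^4 * (n^2 - c^2) * n^2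
      = (m^2/4)^2 + r^2 * m^2 * (n^2 - c^2)/2 + (r^4 * n^2 * c^2 - r^2*m^2*c^2/2) := by ring
  have e4 : 0 ≤ n^2 * ((m^2/4 + r^2 * n^2)^2 - r^2 * m^2 * c^2 - r^4 * (n^2 - c^2) * n^2) := by
    have : n^2 * ((m^2/4 + r^2 * n^2)^2 - r^2 * m^2 * c^2 - r^4 * (n^2 - c^2) * n^2)
      = (n^2 - c^2) * ((m^2/4)^2 + 2 * (m^2/4) * (r^2*n^2)) + c^2 * (m^2/4 - r^2*n^2)^2 := by ring
    rw [this]; positivity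
  have e5 : 0 ≤ (m^2/4 + r^2 * n^2)^2 - r^2 * m^2 * c^2 - r^4 * (n^2 - c^2) * n^2 :=
    nonneg_of_mul_nonneg_right e4 (by linarith)
  have e6 : 0 ≤ r^4 * (n^2 - c^2) := by positivity
  nlinarith

lemma P_formula {d : ℕ} (z w : EuclideanSpace ℝ (Fin d)) (r : ℝ) :
    ‖(1/2 : ℝ) • z + r • w‖ ^ 4 + ‖(1/2 : ℝ) • z - r • w‖ ^ 4 =
      2 * ((‖z‖^2/4 + r^2 * ‖w‖^2)^2 + r^2 * ⟪z, w⟫^2) := by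
  have h4 : ∀ y : EuclideanSpace ℝ (Fin d), ‖y‖^4 = (‖y‖^2)^2 := fun y => by ring
  rw [h4, h4, norm_add_sq_real, norm_sub_sq_real, norm_smul, norm_smul, real_inner_smul_left,
    real_inner_smul_right]
  have hr : ‖r‖ ^ 2 = r ^ 2 := by simp
  simp only [mul_pow, hr]
  norm_num
  ring

lemma radial {n m c : ℝ} (hn : 1 ≤ n) (h : ℝ → ℝ≥0∞) :
    ∫⁻ r in Ioi (0:ℝ), ENNReal.ofReal (r ^ 3) * h (2 * ((m^2/4 + r^2 * n^2)^2 + r^2 * c^2)) ≤ ∫⁻ t, h t := by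
  set f : ℝ → ℝ := fun r => 2 * ((m^2/4 + r^2 * n^2)^2 + r^2 * c^2) with hf
  set f' : ℝ → ℝ := fun r => 2 * (2 * (m^2/4 + r^2 * n^2) * (2 * r * n^2) + 2 * r * c^2) with hf'
  have hder : ∀ r, HasDerivAt f (f' r) r := by
    intro r
    have h1 : HasDerivAt (fun r : ℝ => r^2) (2*r) r := by simpa using hasDerivAt_pow 2 r
    have h2 := ((((h1.mul_const (n^2)).const_add (m^2/4)).pow 2).add (h1.mul_const (c^2))).const_mul 2
    refine h2.congr_deriv ?_
    simp only [hf']; ring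
  have hn2 : 1 ≤ n^2 := one_le_pow₀ hn
  have hmono : StrictMonoOn f (Ioi 0) := by
    intro x hx y hy hxy
    have hx : 0 < x := hx
    have : x^2 < y^2 := by gcongr
    simp only [hf]
    have h3 : x^2 * n^2 < y^2*n^2 := by gcongr
    have h6 : x^2 * c^2 ≤ y^2 * c^2 := by gcongr
    have h7 : (m^2/4 + x^2 * n^2)^2 < (m^2/4 + y^2 * n^2)^2 := by gcongr
    linarith
  have hge : ∀ r ∈ Ioi (0:ℝ), r^3 ≤ |f' r| := by
    intro r hr
    have hr : 0 < r := hr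
    apply le_trans _ (le_abs_self _)
    have h1 : 0 ≤ m^2/4 * (r * n^2) := by positivity
    have h2 : 0 ≤ r * c^2 := by positivity
    have h3 : 1 ≤ n^2 * n^2 := by nlinarith
    have h4 : r^3 ≤ r^3 * (n^2*n^2) := le_mul_of_one_le_right (by positivity) h3
    have h5 : 0 < r^3 := by positivity
    simp only [hf']
    nlinarith
  calc _ ≤ ∫⁻ r in Ioi (0:ℝ), ENNReal.ofReal |f' r| * h (f r) := by
        apply setLIntegral_mono' measurableSet_Ioi
        intro r hr
        have := hge r hr
        gcongr
    _ = ∫⁻ t in f '' Ioi 0, h t :=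
        (lintegral_image_eq_lintegral_abs_deriv_mul measurableSet_Ioi
          (fun r _ => (hder r).hasDerivWithinAt) hmono.injOn h).symm
    _ ≤ _ := setLIntegral_le_lintegral _ _

lemma L3 (d : ℕ) (hd : 4 ≤ d) :
    ∃ C : ℝ≥0∞, C < ⊤ ∧ ∀ (z : EuclideanSpace ℝ (Fin d)) (h : ℝ → ℝ≥0∞), Measurable h →
      ∫⁻ v, h (‖(1/2 : ℝ) • z + v‖ ^ 4 + ‖(1/2 : ℝ) • z - v‖ ^ 4) *
        (ENNReal.ofReal (‖(1/2 : ℝ) • z + v‖^2 * ‖(1/2 : ℝ) • z - v‖^2)) ^ (-(((d:ℝ)-4)/2) / 2) ≤ C * ∫⁻ t, h t := by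
  have hd4 : (4:ℝ) ≤ d := by exact_mod_cast hd
  obtain ⟨J, hJ, hJ'⟩ := L1 d hd (((d:ℝ)-4)/2) (by linarith) (by linarith)
  refine ⟨2 * J, ENNReal.mul_lt_top (by simp) hJ, ?_⟩
  intro z h hh
  obtain ⟨e, he, hz⟩ : ∃ e : EuclideanSpace ℝ (Fin d), ‖e‖ = 1 ∧ z = ‖z‖ • e := by
    by_cases hz : z = 0
    · refine ⟨EuclideanSpace.single ⟨0, by omega⟩ 1, by simp, by simp [hz]⟩
    · refine ⟨‖z‖⁻¹ • z, ?_, ?_⟩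
      · rw [norm_smul, norm_inv, norm_norm, inv_mul_cancel₀ (norm_ne_zero_iff.2 hz)]
      · rw [smul_smul, mul_inv_cancel₀ (norm_ne_zero_iff.2 hz), one_smul]
  refine (L2 _ (by fun_prop) (by omega)).trans ?_
  rw [mul_assoc]
  gcongr
  set p : ℝ := -(((d:ℝ)-4)/2) / 2 with hp
  have hp0 : p ≤ 0 := by rw [hp]; linarith
  calc _ ≤ ∫⁻ w, ({w : EuclideanSpace ℝ (Fin d) | 1 ≤ ‖w‖ ∧ ‖w‖ ≤ 2}.indicator 1 w *
        (ENNReal.ofReal (‖w‖ ^ 2 - ⟪e, w⟫ ^ 2)) ^ p) * ∫⁻ t, h t := by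
        apply lintegral_mono
        intro w
        simp only
        by_cases hm : 1 ≤ ‖w‖ ∧ ‖w‖ ≤ 2
        swap
        · rw [indicator_of_notMem (by exact hm)]; simp
        rw [indicator_of_mem (by exact hm)]
        simp only [Pi.one_apply, one_mul]
        refine le_trans ?_ (mul_le_mul_right (radial (n := ‖w‖) (m := ‖z‖) (c := ⟪z, w⟫) hm.1 h) _)
        refine le_trans ?_ (lintegral_const_mul _ (by fun_prop)).le
        apply setLIntegral_mono' measurableSet_Ioi
        intro r hr
        have hr : 0 < r := hr
        rw [P_formula]
        have hg := geom_ineq z w e r he hz hm.1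
        have hX : (ENNReal.ofReal (‖(1/2 : ℝ) • z + r • w‖^2 * ‖(1/2 : ℝ) • z - r • w‖^2)) ^ p ≤
            ENNReal.ofReal (r ^ (4 * p)) * (ENNReal.ofReal (‖w‖ ^ 2 - ⟪e, w⟫ ^ 2)) ^ p := by
          calc _ ≤ (ENNReal.ofReal (r ^ 4 * (‖w‖ ^ 2 - ⟪e, w⟫ ^ 2))) ^ p := by
                exact enn_anti (ENNReal.ofReal_le_ofReal hg) hp0
            _ = _ := by
                rw [ENNReal.ofReal_mul (by positivity), ENNReal.mul_rpow_of_ne_top (by simp) (by simp),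
                  ENNReal.ofReal_rpow_of_pos (by positivity), ← Real.rpow_natCast, ← Real.rpow_mul hr.le]
                norm_num
        have hrr : ENNReal.ofReal (r ^ (d - 1)) * ENNReal.ofReal (r ^ (4 * p)) = ENNReal.ofReal (r ^ 3) := by
          rw [← ENNReal.ofReal_mul (by positivity), ← Real.rpow_natCast, ← Real.rpow_add hr,
            ← Real.rpow_natCast, Nat.cast_sub (by omega), hp]
          congr 2
          push_cast; ring
        calc _ ≤ ENNReal.ofReal (r ^ (d - 1)) * (h (2 * ((‖z‖^2/4 + r^2 * ‖w‖^2)^2 + r^2 * ⟪z, w⟫^2)) *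
              (ENNReal.ofReal (r ^ (4 * p)) * (ENNReal.ofReal (‖w‖ ^ 2 - ⟪e, w⟫ ^ 2)) ^ p)) := by gcongr
          _ = _ := by rw [← hrr]; ring
    _ = (∫⁻ w, ({w : EuclideanSpace ℝ (Fin d) | 1 ≤ ‖w‖ ∧ ‖w‖ ≤ 2}.indicator 1 w *
        (ENNReal.ofReal (‖w‖ ^ 2 - ⟪e, w⟫ ^ 2)) ^ p)) * ∫⁻ t, h t := by
        rw [lintegral_mul_const]
        apply Measurable.mul _ (by fun_prop)
        apply measurable_one.indicator
        exact (measurableSet_le measurable_const measurable_norm).inter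
          (measurableSet_le measurable_norm measurable_const)
    _ ≤ _ := by gcongr; exact hJ' e he

lemma L4 (d : ℕ) (hd : 4 ≤ d) :
    ∃ C : ℝ≥0∞, C < ⊤ ∧ ∀ (H : ℝ × EuclideanSpace ℝ (Fin d) → ℝ≥0∞), Measurable H →
      ∫⁻ p : EuclideanSpace ℝ (Fin d) × EuclideanSpace ℝ (Fin d),
        H (‖p.1‖ ^ 4 + ‖p.2‖ ^ 4, p.1 + p.2) *
        (ENNReal.ofReal (‖p.1‖^2 * ‖p.2‖^2)) ^ (-(((d:ℝ)-4)/2) / 2) ≤ C * ∫⁻ q, H q := by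
  obtain ⟨C, hC, hC'⟩ := L3 d hd
  refine ⟨C, hC, ?_⟩
  intro H hH
  set p : ℝ := -(((d:ℝ)-4)/2) / 2 with hp
  set f : EuclideanSpace ℝ (Fin d) → EuclideanSpace ℝ (Fin d) → ℝ≥0∞ := fun x y =>
    H (‖x‖ ^ 4 + ‖y‖ ^ 4, x + y) * (ENNReal.ofReal (‖x‖^2 * ‖y‖^2)) ^ p with hf
  have hfm : Measurable (Function.uncurry f) := by
    simp only [hf, Function.uncurry_def]
    fun_prop
  calc _ = ∫⁻ x, ∫⁻ y, f x y := by
        rw [Measure.volume_eq_prod, lintegral_prod _ (by exact hfm.aemeasurable)]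
    _ = ∫⁻ y, ∫⁻ x, f x y := lintegral_lintegral_swap hfm.aemeasurable
    _ = ∫⁻ y, ∫⁻ z, f (z - y) y := by
        apply lintegral_congr
        intro y
        exact (lintegral_sub_right_eq_self (fun x => f x y) y).symm
    _ = ∫⁻ z, ∫⁻ y, f (z - y) y := by
        apply lintegral_lintegral_swap
        apply Measurable.aemeasurable
        exact hfm.comp (g := Function.uncurry f) (f := fun q : EuclideanSpace ℝ (Fin d) × EuclideanSpace ℝ (Fin d) => (q.2 - q.1, q.1)) (by fun_prop)
    _ = ∫⁻ z, ∫⁻ v, f ((1/2:ℝ) • z + v) ((1/2:ℝ) • z - v) := by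
        apply lintegral_congr
        intro z
        rw [← lintegral_sub_left_eq_self (fun y => f (z - y) y) ((1/2:ℝ) • z)]
        apply lintegral_congr
        intro v
        congr 1
        module
    _ ≤ ∫⁻ z, C * ∫⁻ t, H (t, z) := by
        apply lintegral_mono
        intro z
        have := hC' z (fun t => H (t, z)) (by fun_prop)
        refine le_trans (le_of_eq ?_) this
        apply lintegral_congr
        intro v
        simp only [hf]
        congr 3
        have : z = (1/2:ℝ) • z + (1/2:ℝ) • z := by rw [← add_smul]; norm_num
        conv_rhs => rw [this]
        abel_nf
    _ = C * ∫⁻ z, ∫⁻ t, H (t, z) := by rw [lintegral_const_mul' _ _ hC.ne]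
    _ = _ := by
        rw [Measure.volume_eq_prod, lintegral_prod_symm _ hH.aemeasurable]

lemma L5 (d : ℕ) (hd : 4 ≤ d) :
    ∃ C : ℝ≥0∞, C < ⊤ ∧ ∀ (K : ℝ × EuclideanSpace ℝ (Fin d) → ℝ≥0∞)
      (g₁ g₂ : EuclideanSpace ℝ (Fin d) → ℝ≥0∞), Measurable K → Measurable g₁ → Measurable g₂ →
      ∫⁻ p : EuclideanSpace ℝ (Fin d) × EuclideanSpace ℝ (Fin d),
        K (‖p.1‖ ^ 4 + ‖p.2‖ ^ 4, p.1 + p.2) * (g₁ p.1 * g₂ p.2) ≤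
        C * (∫⁻ q, K q ^ 2) ^ (1/2 : ℝ) *
          ((∫⁻ ξ, ENNReal.ofReal (‖ξ‖ ^ (((d:ℝ)-4)/2)) * g₁ ξ ^ 2) ^ (1/2 : ℝ) *
           (∫⁻ ξ, ENNReal.ofReal (‖ξ‖ ^ (((d:ℝ)-4)/2)) * g₂ ξ ^ 2) ^ (1/2 : ℝ)) := by
  obtain ⟨C, hC, hC'⟩ := L4 d hd
  refine ⟨C ^ (1/2 : ℝ), ENNReal.rpow_lt_top_of_nonneg (by norm_num) hC.ne, ?_⟩
  intro K g₁ g₂ hK hg₁ hg₂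
  have : Nonempty (Fin d) := ⟨⟨0, by omega⟩⟩
  have h0 : ∀ᵐ v : EuclideanSpace ℝ (Fin d), v ≠ 0 := by
    simp [ae_iff]
  have h1 : ∀ᵐ p : EuclideanSpace ℝ (Fin d) × EuclideanSpace ℝ (Fin d), p.1 ≠ 0 :=
    Measure.quasiMeasurePreserving_fst.ae h0
  have h2 : ∀ᵐ p : EuclideanSpace ℝ (Fin d) × EuclideanSpace ℝ (Fin d), p.2 ≠ 0 :=
    Measure.quasiMeasurePreserving_snd.ae h0
  set q : ℝ := ((d:ℝ)-4)/2 with hq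
  set X : EuclideanSpace ℝ (Fin d) × EuclideanSpace ℝ (Fin d) → ℝ≥0∞ := fun p =>
    ENNReal.ofReal (‖p.1‖^2 * ‖p.2‖^2) with hX
  set F : EuclideanSpace ℝ (Fin d) × EuclideanSpace ℝ (Fin d) → ℝ≥0∞ := fun p =>
    K (‖p.1‖ ^ 4 + ‖p.2‖ ^ 4, p.1 + p.2) * X p ^ (-q/4) with hF
  set G : EuclideanSpace ℝ (Fin d) × EuclideanSpace ℝ (Fin d) → ℝ≥0∞ := fun p =>
    X p ^ (q/4) * (g₁ p.1 * g₂ p.2) with hG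
  have hXm : Measurable X := by fun_prop
  have hFm : Measurable F := by fun_prop
  have hGm : Measurable G := by fun_prop
  have hsq : ∀ (x : ℝ≥0∞) (r : ℝ), (x ^ r) ^ (2:ℝ) = x ^ (2 * r) := by
    intro x r; rw [← ENNReal.rpow_mul, mul_comm]
  calc _ = ∫⁻ p, (F * G) p := by
        apply lintegral_congr_ae
        filter_upwards [h1, h2] with p hp1 hp2
        have hXpos : 0 < ‖p.1‖^2 * ‖p.2‖^2 := by
          have := norm_pos_iff.2 hp1
          have := norm_pos_iff.2 hp2
          positivity
        have : X p ^ (-q/4) * X p ^ (q/4) = 1 := by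
          rw [← ENNReal.rpow_add _ _ (by simp only [hX]; exact (ENNReal.ofReal_pos.2 hXpos).ne') (by simp only [hX]; exact ENNReal.ofReal_ne_top)]
          rw [neg_div, neg_add_cancel, ENNReal.rpow_zero]
        simp only [Pi.mul_apply, hF, hG]
        calc _ = K (‖p.1‖ ^ 4 + ‖p.2‖ ^ 4, p.1 + p.2) * (X p ^ (-q/4) * X p ^ (q/4)) * (g₁ p.1 * g₂ p.2) := by
              rw [this, mul_one]
          _ = _ := by ring
    _ ≤ (∫⁻ p, F p ^ (2:ℝ)) ^ (1/2:ℝ) * (∫⁻ p, G p ^ (2:ℝ)) ^ (1/2:ℝ) :=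
        ENNReal.lintegral_mul_le_Lp_mul_Lq volume Real.HolderConjugate.two_two hFm.aemeasurable hGm.aemeasurable
    _ ≤ _ := by
        gcongr ?_ * ?_
        · rw [← ENNReal.mul_rpow_of_nonneg _ _ (by norm_num)]
          gcongr
          refine le_trans (le_of_eq ?_) (hC' (fun q => K q ^ 2) (by fun_prop))
          apply lintegral_congr
          intro p
          simp only [hF, hX]
          rw [ENNReal.mul_rpow_of_nonneg _ _ (by norm_num), hsq]
          congr 1
          · simp
          · congr 1; ring
        · rw [← ENNReal.mul_rpow_of_nonneg _ _ (by norm_num)]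
          gcongr
          rw [← lintegral_prod_mul (by fun_prop) (by fun_prop), ← Measure.volume_eq_prod]
          apply le_of_eq
          apply lintegral_congr_ae
          filter_upwards [h1, h2] with p hp1 hp2
          have a1 := norm_pos_iff.2 hp1
          have a2 := norm_pos_iff.2 hp2
          simp only [hG, hX]
          rw [ENNReal.mul_rpow_of_nonneg _ _ (by norm_num), hsq,
            ENNReal.ofReal_rpow_of_pos (by positivity),
            Real.mul_rpow (by positivity) (by positivity), ← Real.rpow_natCast,  ← Real.rpow_natCast,
            ← Real.rpow_mul a1.le, ← Real.rpow_mul a2.le, ENNReal.ofReal_mul (by positivity)]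
          have : ((2:ℕ):ℝ) * (2 * (q/4)) = q := by push_cast; ring
          rw [this, ENNReal.rpow_two, mul_pow]
          ring

open FourierTransform in
lemma plancherel12 {V : Type*} [NormedAddCommGroup V] [InnerProductSpace ℝ V] [FiniteDimensional ℝ V]
    [MeasurableSpace V] [BorelSpace V] (f : V → ℂ) (h1 : Integrable f) (h2 : MemLp f 2 volume) :
    eLpNorm (𝓕 f) 2 volume = eLpNorm f 2 volume := by
  set F : Lp ℂ 2 (volume : Measure V) := h2.toLp f with hF
  have hc : Continuous (𝓕 f) := VectorFourier.fourierIntegral_continuous Real.continuous_fourierChar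
    (by exact continuous_inner) h1
  have hae : 𝓕 f =ᵐ[volume] (𝓕 F : Lp ℂ 2 (volume : Measure V)) := by
    apply ae_eq_of_integral_contDiff_smul_eq hc.locallyIntegrable
      ((Lp.memLp (𝓕 F : Lp ℂ 2 (volume : Measure V))).locallyIntegrable (by norm_num))
    intro g hg hgs
    have hg' : ContDiff ℝ (⊤ : ℕ∞) (fun x => (g x : ℂ)) := Complex.ofRealCLM.contDiff.comp hg
    have hgs' : HasCompactSupport (fun x => (g x : ℂ)) := hgs.comp_left (g := fun x : ℝ => (x : ℂ)) (by simp)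
    set φ : SchwartzMap V ℂ := hgs'.toSchwartzMap hg' with hφ
    have e1 := Lp.fourier_toTemperedDistribution_eq F
    have e2 := congrArg (fun T => T φ) e1
    simp only [TemperedDistribution.fourier_apply, Lp.toTemperedDistribution_apply] at e2
    have e3 : ∫ x, (𝓕 φ) x • F x = ∫ x, (𝓕 φ) x • f x := by
      apply integral_congr_ae
      filter_upwards [h2.coeFn_toLp] with x hx
      rw [hF, hx]
    have e4 := VectorFourier.integral_fourierIntegral_smul_eq_flip (L := innerₗ V) (μ := volume) (ν := volume)
      Real.continuous_fourierChar (by exact continuous_inner) φ.integrable h1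
    rw [flip_innerₗ] at e4
    calc ∫ x, g x • 𝓕 f x = ∫ x, φ x • 𝓕 f x := by
          apply integral_congr_ae
          refine Filter.Eventually.of_forall fun x => ?_
          simp [hφ]
      _ = ∫ x, (𝓕 φ) x • f x := by
          rw [SchwartzMap.fourier_coe]
          exact e4.symm
      _ = ∫ x, φ x • (𝓕 F : Lp ℂ 2 (volume : Measure V)) x := by
          rw [← e3]; exact e2
      _ = _ := by
          apply integral_congr_ae
          refine Filter.Eventually.of_forall fun x => ?_
          simp [hφ]
  rw [eLpNorm_congr_ae hae, ← eLpNorm_congr_ae h2.coeFn_toLp]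
  have := Lp.norm_fourier_eq F
  rw [Lp.norm_def, Lp.norm_def] at this
  exact (ENNReal.toReal_eq_toReal_iff' (Lp.eLpNorm_ne_top _) (Lp.eLpNorm_ne_top _)).1 this

/-- Space-time Fourier transform used for duality. -/
def sthat {d : ℕ} (φ : ℝ × EuclideanSpace ℝ (Fin d) → ℂ) (q : ℝ × EuclideanSpace ℝ (Fin d)) : ℂ :=
  ∫ p : ℝ × EuclideanSpace ℝ (Fin d),
    Complex.exp (Complex.I * ((⟪p.2, q.2⟫ - p.1 * q.1 : ℝ) : ℂ)) * φ p

open FourierTransform in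
lemma sthat_eq {d : ℕ} (φ : ℝ × EuclideanSpace ℝ (Fin d) → ℂ) (q : ℝ × EuclideanSpace ℝ (Fin d)) :
    sthat φ q = 𝓕 (fun v : WithLp 2 (ℝ × EuclideanSpace ℝ (Fin d)) => φ (WithLp.ofLp v))
      (WithLp.toLp 2 ((2 * Real.pi)⁻¹ • q.1, (-(2 * Real.pi)⁻¹) • q.2)) := by
  rw [Real.fourier_eq', sthat]
  rw [← (WithLp.volume_preserving_ofLp ℝ (EuclideanSpace ℝ (Fin d))).integral_comp
    (MeasurableEquiv.toLp 2 (ℝ × EuclideanSpace ℝ (Fin d))).symm.measurableEmbedding]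
  congr 1
  ext v
  rw [smul_eq_mul]
  congr 2
  rw [WithLp.prod_inner_apply, mul_comm]
  congr 2
  simp only [real_inner_smul_right]
  have : ⟪v.ofLp.1, q.1⟫ = v.ofLp.1 * q.1 := by simp [mul_comm]
  rw [this]
  have hpi := Real.pi_ne_zero
  field_simp
  ring

open FourierTransform in
lemma sthat_L2 (d : ℕ) : ∃ C : ℝ≥0∞, C < ⊤ ∧ ∀ φ : ℝ × EuclideanSpace ℝ (Fin d) → ℂ,
    Integrable φ → MemLp φ 2 volume → Continuous (sthat φ) ∧
      ∫⁻ q, ‖sthat φ q‖ₑ ^ 2 ≤ C * ∫⁻ p, ‖φ p‖ₑ ^ 2 := by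
  have hpi : (2 * Real.pi)⁻¹ ≠ 0 := by positivity
  set L : (ℝ × EuclideanSpace ℝ (Fin d)) ≃ₗ[ℝ] (ℝ × EuclideanSpace ℝ (Fin d)) :=
    (LinearEquiv.smulOfNeZero ℝ ℝ (2 * Real.pi)⁻¹ hpi).prodCongr
    (LinearEquiv.smulOfNeZero ℝ (EuclideanSpace ℝ (Fin d)) (-(2 * Real.pi)⁻¹) (by simp)) with hL
  have hdet : LinearMap.det (L : (ℝ × EuclideanSpace ℝ (Fin d)) →ₗ[ℝ] (ℝ × EuclideanSpace ℝ (Fin d))) ≠ 0 :=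
    (LinearEquiv.isUnit_det' L).ne_zero
  have : (volume : Measure (ℝ × EuclideanSpace ℝ (Fin d))).IsAddHaarMeasure := by
    rw [Measure.volume_eq_prod]; infer_instance
  have hmap := Measure.map_linearMap_addHaar_eq_smul_addHaar (volume : Measure (ℝ × EuclideanSpace ℝ (Fin d))) hdet
  refine ⟨_, ENNReal.ofReal_lt_top (r := |(LinearMap.det (L : (ℝ × EuclideanSpace ℝ (Fin d)) →ₗ[ℝ] (ℝ × EuclideanSpace ℝ (Fin d))))⁻¹|), ?_⟩
  intro φ h1 h2
  set φ' : WithLp 2 (ℝ × EuclideanSpace ℝ (Fin d)) → ℂ := fun v => φ (WithLp.ofLp v) with hφ'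
  have hmp := WithLp.volume_preserving_ofLp ℝ (EuclideanSpace ℝ (Fin d))
  have hmp' := WithLp.volume_preserving_toLp ℝ (EuclideanSpace ℝ (Fin d))
  have h1' : Integrable φ' := hmp.integrable_comp_of_integrable h1
  have h2' : MemLp φ' 2 volume := h2.comp_measurePreserving hmp
  have hc : Continuous (𝓕 φ') := VectorFourier.fourierIntegral_continuous Real.continuous_fourierChar
    (by exact continuous_inner) h1'
  have hc2 : Continuous fun q : ℝ × EuclideanSpace ℝ (Fin d) => 𝓕 φ' (WithLp.toLp 2 q) :=
    hc.comp (WithLp.prod_continuous_toLp 2 _ _)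
  have heq : sthat φ = fun q => 𝓕 φ' (WithLp.toLp 2 (L q)) := by
    ext q
    rw [sthat_eq]
    rfl
  have hLc : Continuous L := LinearMap.continuous_of_finiteDimensional (L : (ℝ × EuclideanSpace ℝ (Fin d)) →ₗ[ℝ] (ℝ × EuclideanSpace ℝ (Fin d)))
  refine ⟨heq ▸ hc2.comp hLc, ?_⟩
  have hpl := plancherel12 φ' h1' h2'
  rw [eLpNorm_eq_lintegral_rpow_enorm_toReal (by simp) (by simp), eLpNorm_eq_lintegral_rpow_enorm_toReal (by simp) (by simp)] at hpl
  have hpl2 : ∫⁻ v, ‖𝓕 φ' v‖ₑ ^ 2 = ∫⁻ v, ‖φ' v‖ₑ ^ 2 := by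
    have := ENNReal.rpow_left_injective (x := 1/(2:ℝ≥0∞).toReal) (by simp) hpl
    simpa using this
  apply le_of_eq
  calc ∫⁻ q, ‖sthat φ q‖ₑ ^ 2 = ∫⁻ q, (fun q => ‖𝓕 φ' (WithLp.toLp 2 q)‖ₑ ^ 2) (L q) := by rw [heq]
    _ = ∫⁻ q, ‖𝓕 φ' (WithLp.toLp 2 q)‖ₑ ^ 2 ∂(Measure.map L volume) := by
        rw [lintegral_map (hc2.measurable.enorm.pow_const 2) hLc.measurable]
    _ = ENNReal.ofReal _ * ∫⁻ q, ‖𝓕 φ' (WithLp.toLp 2 q)‖ₑ ^ 2 := by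
        rw [← smul_eq_mul, ← lintegral_smul_measure, ← hmap]
        rfl
    _ = ENNReal.ofReal _ * ∫⁻ v, ‖𝓕 φ' v‖ₑ ^ 2 := by
        rw [hmp'.lintegral_comp (f := fun v => ‖𝓕 φ' v‖ₑ ^ 2) (hc.measurable.enorm.pow_const 2)]
    _ = ENNReal.ofReal _ * ∫⁻ p, ‖φ p‖ₑ ^ 2 := by
        rw [hpl2]
        congr 1
        exact hmp.lintegral_comp_emb (MeasurableEquiv.toLp 2 (ℝ × EuclideanSpace ℝ (Fin d))).symm.measurableEmbedding (fun p => ‖φ p‖ₑ ^ 2)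

/-- Unnormalised free wave with Fourier data `g`. -/
def Uw {d : ℕ} (g : EuclideanSpace ℝ (Fin d) → ℂ) (p : ℝ × EuclideanSpace ℝ (Fin d)) : ℂ :=
  ∫ ξ : EuclideanSpace ℝ (Fin d), Complex.exp (Complex.I * ((⟪p.2, ξ⟫ : ℝ) : ℂ)) *
    (Complex.exp (-Complex.I * (p.1 : ℂ) * ((‖ξ‖ ^ 4 : ℝ) : ℂ)) * g ξ)

/-- Oscillating kernel of the product of two waves. -/
def kern {d : ℕ} (p : ℝ × EuclideanSpace ℝ (Fin d))
    (q : EuclideanSpace ℝ (Fin d) × EuclideanSpace ℝ (Fin d)) : ℂ :=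
  Complex.exp (Complex.I * ((⟪p.2, q.1 + q.2⟫ - p.1 * (‖q.1‖ ^ 4 + ‖q.2‖ ^ 4) : ℝ) : ℂ))

lemma kern_norm {d : ℕ} (p : ℝ × EuclideanSpace ℝ (Fin d))
    (q : EuclideanSpace ℝ (Fin d) × EuclideanSpace ℝ (Fin d)) : ‖kern p q‖ = 1 := by
  rw [kern, mul_comm, Complex.norm_exp_ofReal_mul_I]

lemma kern_cont {d : ℕ} : Continuous (Function.uncurry (kern (d := d))) := by
  unfold kern Function.uncurry
  fun_prop

lemma Uw_mul {d : ℕ} (g₁ g₂ : EuclideanSpace ℝ (Fin d) → ℂ) (p : ℝ × EuclideanSpace ℝ (Fin d)) :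
    Uw g₁ p * Uw g₂ p = ∫ q : EuclideanSpace ℝ (Fin d) × EuclideanSpace ℝ (Fin d),
      kern p q * (g₁ q.1 * g₂ q.2) := by
  rw [Uw, Uw, ← integral_prod_mul, ← Measure.volume_eq_prod]
  congr 1
  ext q
  have : kern p q = (Complex.exp (Complex.I * ((⟪p.2, q.1⟫ : ℝ) : ℂ)) *
    Complex.exp (-Complex.I * (p.1 : ℂ) * ((‖q.1‖ ^ 4 : ℝ) : ℂ))) * (Complex.exp (Complex.I * ((⟪p.2, q.2⟫ : ℝ) : ℂ)) *
    Complex.exp (-Complex.I * (p.1 : ℂ) * ((‖q.2‖ ^ 4 : ℝ) : ℂ))) := by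
    rw [kern, ← Complex.exp_add, ← Complex.exp_add, ← Complex.exp_add, inner_add_right]
    congr 1
    push_cast
    ring
  rw [this]
  ring

lemma dual_id {d : ℕ} (g₁ g₂ : EuclideanSpace ℝ (Fin d) → ℂ) (h₁ : Integrable g₁) (h₂ : Integrable g₂)
    (φ : ℝ × EuclideanSpace ℝ (Fin d) → ℂ) (hφ : Integrable φ) :
    ∫ p, φ p * (Uw g₁ p * Uw g₂ p) =
      ∫ q : EuclideanSpace ℝ (Fin d) × EuclideanSpace ℝ (Fin d),
        sthat φ (‖q.1‖ ^ 4 + ‖q.2‖ ^ 4, q.1 + q.2) * (g₁ q.1 * g₂ q.2) := by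
  have hG : Integrable (fun q : EuclideanSpace ℝ (Fin d) × EuclideanSpace ℝ (Fin d) => g₁ q.1 * g₂ q.2) :=
    h₁.mul_prod h₂
  have hI : Integrable (Function.uncurry fun (p : ℝ × EuclideanSpace ℝ (Fin d))
      (q : EuclideanSpace ℝ (Fin d) × EuclideanSpace ℝ (Fin d)) => kern p q * (φ p * (g₁ q.1 * g₂ q.2)))
      (volume.prod volume) := by
    refine (hφ.mul_prod hG).bdd_mul (c := 1) kern_cont.aestronglyMeasurable ?_
    exact Filter.Eventually.of_forall fun x => (kern_norm x.1 x.2).le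
  calc _ = ∫ p, ∫ q, kern p q * (φ p * (g₁ q.1 * g₂ q.2)) := by
        congr 1
        ext p
        rw [Uw_mul, ← integral_const_mul]
        congr 1
        ext q
        ring
    _ = ∫ q, ∫ p, kern p q * (φ p * (g₁ q.1 * g₂ q.2)) := integral_integral_swap hI
    _ = _ := by
        congr 1
        ext q
        rw [sthat, ← integral_mul_const]
        congr 1
        ext p
        rw [kern]
        ring

lemma L7 (d : ℕ) (hd : 4 ≤ d) : ∃ C : ℝ≥0∞, C < ⊤ ∧ ∀ g₁ g₂ : EuclideanSpace ℝ (Fin d) → ℂ,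
    Measurable g₁ → Measurable g₂ → Integrable g₁ → Integrable g₂ →
    (∫⁻ p, ‖Uw g₁ p * Uw g₂ p‖ₑ ^ 2) ^ (1/2 : ℝ) ≤ C *
          ((∫⁻ ξ, ENNReal.ofReal (‖ξ‖ ^ (((d:ℝ)-4)/2)) * ‖g₁ ξ‖ₑ ^ 2) ^ (1/2 : ℝ) *
           (∫⁻ ξ, ENNReal.ofReal (‖ξ‖ ^ (((d:ℝ)-4)/2)) * ‖g₂ ξ‖ₑ ^ 2) ^ (1/2 : ℝ)) := by
  obtain ⟨C1, hC1, H1⟩ := L5 d hd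
  obtain ⟨C2, hC2, H2⟩ := sthat_L2 d
  refine ⟨C1 * C2 ^ (1/2 : ℝ), ENNReal.mul_lt_top hC1 (ENNReal.rpow_lt_top_of_nonneg (by norm_num) hC2.ne), ?_⟩
  intro g₁ g₂ m₁ m₂ h₁ h₂
  set R := ((∫⁻ ξ, ENNReal.ofReal (‖ξ‖ ^ (((d:ℝ)-4)/2)) * ‖g₁ ξ‖ₑ ^ 2) ^ (1/2 : ℝ) *
           (∫⁻ ξ, ENNReal.ofReal (‖ξ‖ ^ (((d:ℝ)-4)/2)) * ‖g₂ ξ‖ₑ ^ 2) ^ (1/2 : ℝ)) with hR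
  set F : ℝ × EuclideanSpace ℝ (Fin d) → ℂ := fun p => Uw g₁ p * Uw g₂ p with hF
  have hFeq : F = fun p => ∫ q : EuclideanSpace ℝ (Fin d) × EuclideanSpace ℝ (Fin d),
      kern p q * (g₁ q.1 * g₂ q.2) := by
    ext p; exact Uw_mul g₁ g₂ p
  have hFm : StronglyMeasurable F := by
    rw [hFeq]
    apply StronglyMeasurable.integral_prod_right (f := fun p q => kern p q * (g₁ q.1 * g₂ q.2))
    apply Measurable.stronglyMeasurable
    exact kern_cont.measurable.mul (by fun_prop)
  obtain ⟨M, hM⟩ : ∃ M : ℝ, ∀ p, ‖F p‖ ≤ M := by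
    refine ⟨∫ q : EuclideanSpace ℝ (Fin d) × EuclideanSpace ℝ (Fin d), ‖g₁ q.1 * g₂ q.2‖, fun p => ?_⟩
    rw [hFeq]
    refine (norm_integral_le_integral_norm _).trans (le_of_eq ?_)
    congr 1
    ext q
    rw [norm_mul, kern_norm, one_mul]
  -- truncated bound
  have key : ∀ B : Set (ℝ × EuclideanSpace ℝ (Fin d)), MeasurableSet B → volume B < ⊤ →
      ∫⁻ p in B, ‖F p‖ₑ ^ 2 ≤ (C1 * C2 ^ (1/2 : ℝ) * R) ^ 2 := by
    intro B hB hBfin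
    set φ : ℝ × EuclideanSpace ℝ (Fin d) → ℂ := B.indicator (fun p => (starRingEnd ℂ) (F p)) with hφ
    have hconj : StronglyMeasurable (fun p => (starRingEnd ℂ) (F p)) := Complex.continuous_conj.comp_stronglyMeasurable hFm
    have : IsFiniteMeasure (volume.restrict B) := ⟨by simpa using hBfin⟩
    have hφ1 : Integrable φ := by
      rw [hφ, integrable_indicator_iff hB]
      exact Integrable.of_bound hconj.aestronglyMeasurable M (Filter.Eventually.of_forall fun p => by simpa using hM p)
    have hφ2 : MemLp φ 2 volume := by
      rw [hφ, memLp_indicator_iff_restrict hB]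
      exact MemLp.of_bound hconj.aestronglyMeasurable M (Filter.Eventually.of_forall fun p => by simpa using hM p)
    obtain ⟨hcont, hL2⟩ := H2 φ hφ1 hφ2
    set N := ∫⁻ p in B, ‖F p‖ₑ ^ 2 with hN
    have hNφ : ∫⁻ p, ‖φ p‖ₑ ^ 2 = N := by
      rw [hN, ← lintegral_indicator hB]
      apply lintegral_congr
      intro p
      by_cases hp : p ∈ B
      · simp [hφ, hp]
      · simp [hφ, hp]
    have hNfin : N < ⊤ := by
      have := hφ2.2
      rw [eLpNorm_lt_top_iff_lintegral_rpow_enorm_lt_top (by simp) (by simp)] at this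
      rw [← hNφ]
      simpa using this
    have hNle : N ≤ ‖∫ p, φ p * F p‖ₑ := by
      have e1 : ∫ p, φ p * F p = ((∫ p in B, ‖F p‖ ^ 2 : ℝ) : ℂ) := by
        rw [← integral_complex_ofReal, ← integral_indicator hB]
        congr 1
        ext p
        by_cases hp : p ∈ B
        · simp only [hφ, indicator_of_mem hp]
          rw [mul_comm, Complex.mul_conj, Complex.normSq_eq_norm_sq]
        · simp [hφ, hp]
      have e2 : N = ENNReal.ofReal (∫ p in B, ‖F p‖ ^ 2) := by
        rw [ofReal_integral_eq_lintegral_ofReal]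
        · rw [hN]
          apply lintegral_congr
          intro p
          rw [ENNReal.ofReal_pow (norm_nonneg _), ofReal_norm]
        · exact Integrable.of_bound (hFm.norm.pow 2).aestronglyMeasurable (M^2) (Filter.Eventually.of_forall fun p => by
            rw [norm_pow, norm_norm]; gcongr; exact hM p)
        · exact Filter.Eventually.of_forall fun p => by positivity
      rw [e1, e2, ← ofReal_norm, Complex.norm_real]
      exact ENNReal.ofReal_le_ofReal (le_abs_self _)
    have hmain : N ≤ C1 * (C2 * N) ^ (1/2 : ℝ) * R := by
      calc N ≤ ‖∫ p, φ p * F p‖ₑ := hNle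
        _ = ‖∫ q : EuclideanSpace ℝ (Fin d) × EuclideanSpace ℝ (Fin d),
              sthat φ (‖q.1‖ ^ 4 + ‖q.2‖ ^ 4, q.1 + q.2) * (g₁ q.1 * g₂ q.2)‖ₑ := by
            rw [← dual_id g₁ g₂ h₁ h₂ φ hφ1]
        _ ≤ ∫⁻ q : EuclideanSpace ℝ (Fin d) × EuclideanSpace ℝ (Fin d),
              ‖sthat φ (‖q.1‖ ^ 4 + ‖q.2‖ ^ 4, q.1 + q.2) * (g₁ q.1 * g₂ q.2)‖ₑ :=
            enorm_integral_le_lintegral_enorm _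
        _ = ∫⁻ q : EuclideanSpace ℝ (Fin d) × EuclideanSpace ℝ (Fin d),
              ‖sthat φ (‖q.1‖ ^ 4 + ‖q.2‖ ^ 4, q.1 + q.2)‖ₑ * (‖g₁ q.1‖ₑ * ‖g₂ q.2‖ₑ) := by
            simp only [enorm_mul]
        _ ≤ C1 * (∫⁻ q, ‖sthat φ q‖ₑ ^ 2) ^ (1/2 : ℝ) * R :=
            H1 (fun q => ‖sthat φ q‖ₑ) (fun x => ‖g₁ x‖ₑ) (fun x => ‖g₂ x‖ₑ) hcont.measurable.enorm
              m₁.enorm m₂.enorm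
        _ ≤ _ := by
            gcongr
            rw [← hNφ]
            exact hL2
    rw [ENNReal.mul_rpow_of_nonneg _ _ (by norm_num)] at hmain
    by_cases hN0 : N = 0
    · rw [hN0]; exact zero_le
    set s := N ^ (1/2 : ℝ) with hs
    have hss : N = s * s := by
      rw [hs, ← ENNReal.rpow_add_of_nonneg _ _ (by norm_num) (by norm_num)]; norm_num
    have hs0 : s ≠ 0 := by rintro h; rw [h] at hss; simp at hss; exact hN0 hss
    have hst : s ≠ ⊤ := by rintro h; rw [h] at hss; simp at hss; exact hNfin.ne hss
    have : s ≤ C1 * C2 ^ (1/2 : ℝ) * R := by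
      rw [← ENNReal.mul_le_mul_iff_right hs0 hst, ← hss]
      refine hmain.trans (le_of_eq ?_)
      ring
    rw [hss, ← pow_two]
    gcongr
  have hall : ∫⁻ p, ‖F p‖ₑ ^ 2 ≤ (C1 * C2 ^ (1/2 : ℝ) * R) ^ 2 := by
    rw [← setLIntegral_univ, ← iUnion_spanningSets (volume : Measure (ℝ × EuclideanSpace ℝ (Fin d))),
      setLIntegral_iUnion_of_directed _ (monotone_spanningSets _).directed_le]
    exact iSup_le fun n => key _ (measurableSet_spanningSets _ n) (measure_spanningSets_lt_top _ n)
  calc _ ≤ ((C1 * C2 ^ (1/2 : ℝ) * R) ^ 2) ^ (1/2 : ℝ) := by gcongr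
    _ = _ := by
      rw [← ENNReal.rpow_two, ← ENNReal.rpow_mul]; norm_num

lemma integrable_of_unimod_mul {d : ℕ} (θ : EuclideanSpace ℝ (Fin d) → ℝ) (hθ : Continuous θ)
    (f : EuclideanSpace ℝ (Fin d) → ℂ)
    (h : Integrable fun x => Complex.exp ((θ x : ℂ) * Complex.I) * f x) : Integrable f := by
  have hc : Continuous fun x => Complex.exp (((-θ x : ℝ) : ℂ) * Complex.I) := by fun_prop
  have := h.bdd_mul (c := 1) hc.aestronglyMeasurable
    (Filter.Eventually.of_forall fun x => (Complex.norm_exp_ofReal_mul_I _).le)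
  refine this.congr (Filter.Eventually.of_forall fun x => ?_)
  simp only
  rw [← mul_assoc, ← Complex.exp_add]
  simp

lemma ftd_measurable {d : ℕ} (f : EuclideanSpace ℝ (Fin d) → ℂ) : Measurable (ftd f) := by
  by_cases hf : Integrable f
  · apply Continuous.measurable
    unfold ftd
    refine continuous_of_dominated (bound := fun x => ‖f x‖) ?_ ?_ hf.norm ?_
    · intro ξ
      have hc : Continuous fun x : EuclideanSpace ℝ (Fin d) =>
        Complex.exp (-Complex.I * ((⟪x, ξ⟫ : ℝ) : ℂ)) := by fun_prop
      exact hc.aestronglyMeasurable.mul hf.1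
    · intro ξ
      refine Filter.Eventually.of_forall fun x => ?_
      have : -Complex.I * ((⟪x, ξ⟫ : ℝ) : ℂ) = ((-⟪x, ξ⟫ : ℝ) : ℂ) * Complex.I := by
        push_cast; ring
      rw [this, norm_mul, Complex.norm_exp_ofReal_mul_I, one_mul]
    · refine Filter.Eventually.of_forall fun x => ?_
      fun_prop
  · have : ftd f = fun _ => 0 := by
      ext ξ
      unfold ftd
      apply integral_undef
      intro h
      apply hf
      apply integrable_of_unimod_mul (fun x => -⟪x, ξ⟫) (by fun_prop)
      refine h.congr (Filter.Eventually.of_forall fun x => ?_)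
      simp only
      congr 2
      push_cast; ring
    rw [this]; fun_prop

lemma Uw_undef {d : ℕ} (g : EuclideanSpace ℝ (Fin d) → ℂ) (hg : ¬ Integrable g)
    (p : ℝ × EuclideanSpace ℝ (Fin d)) : Uw g p = 0 := by
  apply integral_undef
  intro h
  apply hg
  apply integrable_of_unimod_mul (fun ξ => ⟪p.2, ξ⟫ - p.1 * ‖ξ‖ ^ 4) (by fun_prop)
  refine h.congr (Filter.Eventually.of_forall fun ξ => ?_)
  simp only
  rw [← mul_assoc, ← Complex.exp_add]
  congr 2
  push_cast; ring

/-- bilinear `L²_{t,x}` estimate for two free biharmonic waves in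
dimension `d ≥ 4`. -/
theorem bilinear_free_estimate (d : ℕ) (hd : 4 ≤ d) :
    ∃ C > (0:ℝ), ∀ f₁ f₂ : EuclideanSpace ℝ (Fin d) → ℂ,
      HsHomNormd (((d : ℝ) - 4)/4) f₁ < ⊤ →
      HsHomNormd (((d : ℝ) - 4)/4) f₂ < ⊤ →
      L2txNorm (fun t x => bpropd t f₁ x * bpropd t f₂ x) ≤
        ENNReal.ofReal C * HsHomNormd (((d : ℝ) - 4)/4) f₁ *
          HsHomNormd (((d : ℝ) - 4)/4) f₂ := by
  obtain ⟨C, hC, H⟩ := L7 d hd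
  set k : ℝ := ((2 * Real.pi) ^ d)⁻¹ with hk
  have hk0 : 0 < k := by positivity
  refine ⟨k ^ 2 * (C.toReal + 1), by positivity, ?_⟩
  intro f₁ f₂ _ _
  have hprod : ∀ p : ℝ × EuclideanSpace ℝ (Fin d), bpropd p.1 f₁ p.2 * bpropd p.1 f₂ p.2 =
      (k ^ 2 : ℝ) • (Uw (ftd f₁) p * Uw (ftd f₂) p) := by
    intro p
    have : ∀ f, bpropd p.1 f p.2 = k • Uw (ftd f) p := fun f => rfl
    rw [this, this, smul_mul_smul_comm, pow_two]
  have hHs : ∀ f : EuclideanSpace ℝ (Fin d) → ℂ, HsHomNormd (((d : ℝ) - 4)/4) f =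
      (∫⁻ ξ, ENNReal.ofReal (‖ξ‖ ^ (((d:ℝ)-4)/2)) * ‖ftd f ξ‖ₑ ^ 2) ^ (1/2 : ℝ) := by
    intro f
    rw [HsHomNormd]
    congr 1
    apply lintegral_congr
    intro ξ
    rw [ENNReal.ofReal_mul (by positivity), ENNReal.ofReal_pow (norm_nonneg _), ofReal_norm]
    congr 3
    ring
  by_cases hint : Integrable (ftd f₁) ∧ Integrable (ftd f₂)
  swap
  · have hz : ∀ p : ℝ × EuclideanSpace ℝ (Fin d), bpropd p.1 f₁ p.2 * bpropd p.1 f₂ p.2 = 0 := by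
      intro p
      rw [hprod]
      rw [not_and_or] at hint
      rcases hint with h | h <;> simp [Uw_undef _ h]
    rw [L2txNorm]
    simp [hz]
  have hmain := H _ _ (ftd_measurable f₁) (ftd_measurable f₂) hint.1 hint.2
  rw [← hHs, ← hHs] at hmain
  have hL : L2txNorm (fun t x => bpropd t f₁ x * bpropd t f₂ x) =
      ENNReal.ofReal (k ^ 2) * (∫⁻ p, ‖Uw (ftd f₁) p * Uw (ftd f₂) p‖ₑ ^ 2) ^ (1/2 : ℝ) := by
    rw [L2txNorm]
    have e1 : ∀ p : ℝ × EuclideanSpace ℝ (Fin d),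
        ENNReal.ofReal (‖bpropd p.1 f₁ p.2 * bpropd p.1 f₂ p.2‖ ^ 2) =
        ENNReal.ofReal (k ^ 2) ^ 2 * ‖Uw (ftd f₁) p * Uw (ftd f₂) p‖ₑ ^ 2 := by
      intro p
      rw [hprod, norm_smul, mul_pow, ENNReal.ofReal_mul (by positivity),
        ENNReal.ofReal_pow (norm_nonneg _), ENNReal.ofReal_pow (norm_nonneg _), ofReal_norm (Uw _ _ * _),
        Real.norm_of_nonneg (by positivity)]
    simp only [e1]
    rw [lintegral_const_mul' _ _ (by finiteness), ENNReal.mul_rpow_of_nonneg _ _ (by norm_num)]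
    congr 1
    rw [← ENNReal.rpow_two, ← ENNReal.rpow_mul]; norm_num
  rw [hL, ENNReal.ofReal_mul (by positivity), mul_assoc, mul_assoc]
  gcongr
  refine hmain.trans ?_
  gcongr
  rw [← ENNReal.ofReal_toReal hC.ne]
  apply ENNReal.ofReal_le_ofReal
  simp
end
end

section
/- Let 8/7 < s < 2. There is a constant C such that for every λ ≥ 1, every N ≥ 1 and every u₀ ∈ H^s(ℝ²), the rescaled datum u_{0,λ}(x) := λ⁻¹ u₀(x/λ) satisfies E(I_N u_{0,λ}) ≤ C ( λ^{−2s} N^{2(2−s)} + λ^{−4} ) (1 + ‖u₀‖_{H^s(ℝ²)})⁶, and in particular E(I_N u_{0,λ}) ≤ C λ^{−2s} N^{2(2−s)} (1 + ‖u₀‖_{H^s(ℝ²)})⁶. -/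
open MeasureTheory Set
open scoped RealInnerProductSpace ENNReal NNReal

noncomputable section

abbrev E2 : Type := EuclideanSpace ℝ (Fin 2)

/-- Spatial Fourier transform, convention `f̂(ξ) = ∫ e^{-i x·ξ} f(x) dx`. -/
def ft (f : E2 → ℂ) (ξ : E2) : ℂ :=
  ∫ x : E2, Complex.exp (-Complex.I * ((⟪x, ξ⟫ : ℝ) : ℂ)) * f x

/-- Inverse Fourier transform on ℝ². -/
def invFt (g : E2 → ℂ) (x : E2) : ℂ :=
  (((2 * Real.pi) ^ 2)⁻¹ : ℝ) • ∫ ξ : E2, Complex.exp (Complex.I * ((⟪x, ξ⟫ : ℝ) : ℂ)) * g ξ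

/-- Biharmonic Schrödinger propagator `e^{itΔ²}`, the Fourier multiplier with
symbol `e^{-it|ξ|⁴}`. -/
def bprop (t : ℝ) (φ : E2 → ℂ) : E2 → ℂ :=
  invFt fun ξ => Complex.exp (-Complex.I * (t : ℂ) * ((‖ξ‖ ^ 4 : ℝ) : ℂ)) * ft φ ξ

/-- The operator `|∇|^μ`, Fourier multiplier with symbol `|ξ|^μ`. -/
def fracGrad (μ : ℝ) (f : E2 → ℂ) : E2 → ℂ :=
  invFt fun ξ => ((‖ξ‖ ^ μ : ℝ) : ℂ) * ft f ξ

/-- The operator `⟨∇⟩^s`, Fourier multiplier with symbol `⟨ξ⟩^s`. -/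
def jap (s : ℝ) (f : E2 → ℂ) : E2 → ℂ :=
  invFt fun ξ => (((1 + ‖ξ‖ ^ 2) ^ (s / 2) : ℝ) : ℂ) * ft f ξ

/-- A general Fourier multiplier operator with real symbol `m`. -/
def mulOp (m : E2 → ℝ) (f : E2 → ℂ) : E2 → ℂ :=
  invFt fun ξ => ((m ξ : ℝ) : ℂ) * ft f ξ

/-- Inhomogeneous Sobolev norm `‖f‖_{H^s} = ‖⟨ξ⟩^s f̂‖_{L²}`. -/
def HsNorm (s : ℝ) (f : E2 → ℂ) : ℝ≥0∞ :=
  (∫⁻ ξ : E2, ENNReal.ofReal ((1 + ‖ξ‖ ^ 2) ^ s * ‖ft f ξ‖ ^ 2)) ^ (1/2 : ℝ)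

/-- Homogeneous Sobolev norm `‖f‖_{Ḣ^s} = ‖|ξ|^s f̂‖_{L²}`. -/
def HsHomNorm (s : ℝ) (f : E2 → ℂ) : ℝ≥0∞ :=
  (∫⁻ ξ : E2, ENNReal.ofReal (‖ξ‖ ^ (2 * s) * ‖ft f ξ‖ ^ 2)) ^ (1/2 : ℝ)

/-- Spatial Laplacian of a function on ℝ². -/
def lap (f : E2 → ℂ) (x : E2) : ℂ :=
  ∑ i : Fin 2,
    fderiv ℝ (fun y => fderiv ℝ f y (EuclideanSpace.single i (1:ℝ))) x
      (EuclideanSpace.single i (1:ℝ))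

/-- Bi-Laplacian `Δ²`. -/
def bilap (f : E2 → ℂ) : E2 → ℂ := lap (lap f)

/-- Integrand of the energy. -/
def energyIntegrand (v : E2 → ℂ) (x : E2) : ℝ :=
  (1/2) * ‖lap v x‖ ^ 2 + (1/6) * ‖v x‖ ^ 6

/-- Energy `E(v) = ∫ (1/2)|Δv|² + (1/6)|v|⁶`. -/
def energy (v : E2 → ℂ) : ℝ := ∫ x : E2, energyIntegrand v x

/-- The quintic nonlinearity `|v|⁴ v`. -/
def quintic (v : E2 → ℂ) (x : E2) : ℂ := ((‖v x‖ : ℝ) : ℂ) ^ 4 * v x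

/-- Space-time Fourier transform. -/
def stFt (u : ℝ → E2 → ℂ) (τ : ℝ) (ξ : E2) : ℂ :=
  ∫ t : ℝ, ∫ x : E2,
    Complex.exp (-Complex.I * (((⟪x, ξ⟫ : ℝ) : ℂ) + (t : ℂ) * (τ : ℂ))) * u t x

/-- Fourier restriction norm `‖u‖_{X^{s,b}}` adapted to the biharmonic equation. -/
def XNorm (s b : ℝ) (u : ℝ → E2 → ℂ) : ℝ≥0∞ :=
  (∫⁻ p : ℝ × E2,
      ENNReal.ofReal ((1 + ‖p.2‖ ^ 2) ^ s * (1 + (p.1 + ‖p.2‖ ^ 4) ^ 2) ^ b *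
        ‖stFt u p.1 p.2‖ ^ 2)) ^ (1/2 : ℝ)

/-- Restricted norm `‖u‖_{X^{s,b}_δ}` (infimum over extensions off `[0,δ]`). -/
def XNormR (s b δ : ℝ) (u : ℝ → E2 → ℂ) : ℝ≥0∞ :=
  ⨅ v ∈ {v : ℝ → E2 → ℂ | ∀ t ∈ Icc (0:ℝ) δ, ∀ x, v t x = u t x}, XNorm s b v

/-- Mixed norm `‖f‖_{L^q_t L^p_x (I × ℝ²)}`. -/
def mixedNorm (q p : ℝ≥0∞) (I : Set ℝ) (f : ℝ → E2 → ℂ) : ℝ≥0∞ :=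
  if q = ∞ then essSup (fun t => eLpNorm (f t) p volume) (volume.restrict I)
  else (∫⁻ t in I, (eLpNorm (f t) p volume) ^ q.toReal) ^ (1 / q.toReal)

/-- `u` satisfies the Duhamel formula for the quintic biharmonic NLS on `I` with data `u₀`. -/
def DuhamelOn (I : Set ℝ) (u : ℝ → E2 → ℂ) (u₀ : E2 → ℂ) : Prop :=
  ∀ t ∈ I, ∀ x : E2,
    u t x = bprop t u₀ x - Complex.I * ∫ t' in (0:ℝ)..t, bprop (t - t') (quintic (u t')) x

/-- `u` is a continuous curve in `H^s` on the time interval `I`. -/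
def ContHs (s : ℝ) (I : Set ℝ) (u : ℝ → E2 → ℂ) : Prop :=
  (∀ t ∈ I, HsNorm s (u t) < ⊤) ∧
  ∀ t₀ ∈ I, ∀ η : ℝ, 0 < η → ∃ τ > 0, ∀ t ∈ I, |t - t₀| < τ →
    HsNorm s (fun x => u t x - u t₀ x) < ENNReal.ofReal η

/-- `m` is an admissible `I`-method multiplier `m_N` of regularity `s`,
with derivative constants `Cd`. -/
structure IsIMult (s N : ℝ) (Cd : ℕ → ℝ) (m : E2 → ℝ) : Prop where
  smooth : ContDiff ℝ (⊤ : ℕ∞) m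
  pos : ∀ ξ, 0 < m ξ
  le_one : ∀ ξ, m ξ ≤ 1
  mono : ∀ ξ η : E2, ‖ξ‖ ≤ ‖η‖ → m η ≤ m ξ
  eq_one : ∀ ξ : E2, ‖ξ‖ ≤ N → m ξ = 1
  eq_rpow : ∀ ξ : E2, 2 * N ≤ ‖ξ‖ → m ξ = (‖ξ‖ / N) ^ (s - 2)
  deriv_bound : ∀ (j : ℕ) (ξ : E2), ξ ≠ 0 →
    ‖iteratedFDeriv ℝ j m ξ‖ ≤ Cd j * ‖ξ‖ ^ (-(j : ℝ))

open scoped FourierTransform SchwartzMap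

lemma plancherel_aux (g : E2 → ℂ) (hg1 : Integrable g) (hg2 : MemLp g 2) :
    (𝓕⁻ g) =ᵐ[volume] (𝓕⁻ (hg2.toLp g) : Lp (α := E2) ℂ 2 volume) := by
  have hcont : Continuous (𝓕⁻ g) := by
    rw [Real.fourierInv_eq_fourier_comp_neg]
    exact VectorFourier.fourierIntegral_continuous Real.continuous_fourierChar
      (by exact continuous_inner) hg1.comp_neg
  apply ae_eq_of_integral_contDiff_smul_eq
  · exact hcont.locallyIntegrable
  · exact (Lp.memLp _).locallyIntegrable (by norm_num)
  intro φ hφ hφc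
  set ψ : 𝓢(E2, ℂ) := (hφc.comp_left (g := Complex.ofReal) rfl).toSchwartzMap
    (Complex.ofRealCLM.contDiff.comp hφ) with hψ
  have hψa : ∀ x, ψ x = (φ x : ℂ) := fun x => rfl
  have h1 := congrArg (fun T => T ψ) (Lp.fourierInv_toTemperedDistribution_eq (hg2.toLp g))
  simp only [Lp.toTemperedDistribution_apply, TemperedDistribution.fourierInv_apply] at h1
  have h2 : ∫ x, (𝓕⁻ ψ) x • (hg2.toLp g) x = ∫ x, (𝓕⁻ ψ) x • g x := by
    apply integral_congr_ae
    filter_upwards [hg2.coeFn_toLp] with x hx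
    rw [hx]
  have h3 : ∫ x, (𝓕⁻ g) x • ψ x = ∫ x, g x • (𝓕⁻ ψ) x := by
    rw [SchwartzMap.fourierInv_coe]
    have hfl : (-innerₗ E2).flip = -innerₗ E2 := by
      ext x y; simp [real_inner_comm]
    have := VectorFourier.integral_fourierIntegral_smul_eq_flip (L := -innerₗ E2)
      Real.continuous_fourierChar (by
        simp only [LinearMap.neg_apply]
        exact continuous_inner.neg) hg1 (ψ.integrable (μ := volume))
    rw [hfl] at this
    exact this
  calc ∫ x, φ x • (𝓕⁻ g) x = ∫ x, (𝓕⁻ g) x • ψ x := by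
        congr 1; ext x; simp [hψa, mul_comm]
    _ = ∫ x, (𝓕⁻ ψ) x • g x := by rw [h3]; congr 1; ext x; simp [mul_comm]
    _ = ∫ x, ψ x • (𝓕⁻ (hg2.toLp g) : Lp (α := E2) ℂ 2 volume) x := by rw [← h1, h2]
    _ = _ := by congr 1

lemma plancherel_inv (g : E2 → ℂ) (hg1 : Integrable g) (hg2 : MemLp g 2) :
    eLpNorm (𝓕⁻ g) 2 volume = eLpNorm g 2 volume := by
  rw [eLpNorm_congr_ae (plancherel_aux g hg1 hg2)]
  have h : ‖(𝓕⁻ (hg2.toLp g) : Lp (α := E2) ℂ 2 volume)‖ = ‖hg2.toLp g‖ := by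
    rw [← Lp.norm_fourier_eq, FourierTransform.fourier_fourierInv_eq]
  rw [Lp.norm_def, Lp.norm_def, ENNReal.toReal_eq_toReal_iff' (Lp.eLpNorm_ne_top _) (Lp.eLpNorm_ne_top _)] at h
  rw [h, eLpNorm_congr_ae hg2.coeFn_toLp]

lemma invFt_eq (g : E2 → ℂ) (x : E2) :
    invFt g x = (((2 * Real.pi) ^ 2)⁻¹ : ℝ) • 𝓕⁻ g ((2 * Real.pi)⁻¹ • x) := by
  rw [invFt, Real.fourierInv_eq']
  congr 2
  ext ξ
  rw [smul_eq_mul, real_inner_smul_right, real_inner_comm]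
  congr 2
  have : (Real.pi : ℂ) ≠ 0 := by exact_mod_cast Real.pi_ne_zero
  push_cast
  field_simp

lemma invFt_continuous (g : E2 → ℂ) (hg1 : Integrable g) : Continuous (invFt g) := by
  have hcont : Continuous (𝓕⁻ g) := by
    rw [Real.fourierInv_eq_fourier_comp_neg]
    exact VectorFourier.fourierIntegral_continuous Real.continuous_fourierChar
      (by exact continuous_inner) hg1.comp_neg
  have : invFt g = fun x => (((2 * Real.pi) ^ 2)⁻¹ : ℝ) • 𝓕⁻ g ((2 * Real.pi)⁻¹ • x) := by
    ext x; exact invFt_eq g x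
  rw [this]
  fun_prop

lemma invFt_plancherel (g : E2 → ℂ) (hg1 : Integrable g) (hg2 : MemLp g 2) :
    eLpNorm (invFt g) 2 volume ≤ eLpNorm g 2 volume := by
  have : invFt g = (((2 * Real.pi) ^ 2)⁻¹ : ℝ) • fun x => 𝓕⁻ g ((2 * Real.pi)⁻¹ • x) := by
    ext x; exact invFt_eq g x
  have hpi : 0 < 2 * Real.pi := by positivity
  have hcont : Continuous (𝓕⁻ g) := by
    rw [Real.fourierInv_eq_fourier_comp_neg]
    exact VectorFourier.fourierIntegral_continuous Real.continuous_fourierChar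
      (by exact continuous_inner) hg1.comp_neg
  have h1 : eLpNorm (fun x => 𝓕⁻ g ((2 * Real.pi)⁻¹ • x)) 2 volume
      = ENNReal.ofReal (2 * Real.pi) * eLpNorm g 2 volume := by
    have hm := Measure.map_addHaar_smul (volume : Measure E2) (r := (2 * Real.pi)⁻¹) (by positivity)
    have := eLpNorm_map_measure (p := 2) (μ := (volume : Measure E2)) (g := 𝓕⁻ g)
      (f := fun x : E2 => (2 * Real.pi)⁻¹ • x) hcont.aestronglyMeasurable (by fun_prop)
    rw [← Function.comp_def (𝓕⁻ g), ← this]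
    erw [hm]
    rw [eLpNorm_smul_measure_of_ne_top (by norm_num), plancherel_inv g hg1 hg2]
    rw [smul_eq_mul]
    congr 1
    simp only [finrank_euclideanSpace, Fintype.card_fin, inv_pow, inv_inv]
    rw [abs_of_nonneg (by positivity), ENNReal.ofReal_rpow_of_nonneg (by positivity) (by norm_num)]
    congr 1
    norm_num
    rw [← Real.sqrt_eq_rpow, Real.sqrt_sq (by positivity)]
  rw [this, eLpNorm_const_smul, h1, ← mul_assoc]
  refine mul_le_of_le_one_left' ?_
  rw [Real.enorm_of_nonneg (by positivity), ← ENNReal.ofReal_mul (by positivity)]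
  rw [← ENNReal.ofReal_one]
  apply ENNReal.ofReal_le_ofReal
  have : (1:ℝ) ≤ 2 * Real.pi := by linarith [Real.pi_gt_three]
  rw [inv_mul_le_iff₀ (by positivity)]
  nlinarith

open Filter Topology

lemma invFt_hasDerivAt (g : E2 → ℂ) (hg : Integrable g) (e x : E2)
    (hg' : Integrable (fun ξ => Complex.I * ((⟪e, ξ⟫ : ℝ) : ℂ) * g ξ)) (t : ℝ) :
    HasDerivAt (fun t : ℝ => invFt g (x + t • e))
      (invFt (fun ξ => Complex.I * ((⟪e, ξ⟫ : ℝ) : ℂ) * g ξ) (x + t • e)) t := by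
  unfold invFt
  refine HasDerivAt.fun_const_smul (((2 * Real.pi) ^ 2)⁻¹ : ℝ) ?_
  have hnorm : ∀ r : ℝ, ‖Complex.exp (Complex.I * (r : ℂ))‖ = 1 := fun r => by
    rw [mul_comm]; exact Complex.norm_exp_ofReal_mul_I r
  have hmeas : ∀ (y : E2) (q : E2 → ℂ), AEStronglyMeasurable q volume →
      AEStronglyMeasurable (fun ξ => Complex.exp (Complex.I * ((⟪y, ξ⟫ : ℝ) : ℂ)) * q ξ) volume := by
    intro y q hq
    refine AEStronglyMeasurable.mul (Continuous.aestronglyMeasurable ?_) hq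
    fun_prop
  refine (hasDerivAt_integral_of_dominated_loc_of_deriv_le (s := Set.univ)
    (F := fun (t : ℝ) ξ => Complex.exp (Complex.I * ((⟪x + t • e, ξ⟫ : ℝ) : ℂ)) * g ξ)
    (F' := fun (t : ℝ) ξ => Complex.exp (Complex.I * ((⟪x + t • e, ξ⟫ : ℝ) : ℂ)) *
      (Complex.I * ((⟪e, ξ⟫ : ℝ) : ℂ) * g ξ))
    (bound := fun ξ => ‖Complex.I * ((⟪e, ξ⟫ : ℝ) : ℂ) * g ξ‖)
    Filter.univ_mem ?_ ?_ ?_ ?_ ?_ ?_).2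
  · exact Eventually.of_forall fun t => hmeas _ _ hg.1
  · refine hg.mono (hmeas _ _ hg.1) (ae_of_all _ fun ξ => ?_)
    rw [norm_mul, hnorm, one_mul]
  · exact hmeas _ _ hg'.1
  · refine ae_of_all _ fun ξ t _ => ?_
    rw [norm_mul, hnorm, one_mul]
  · exact hg'.norm
  · refine ae_of_all _ fun ξ t _ => ?_
    have h1 : HasDerivAt (fun t : ℝ => ⟪x + t • e, ξ⟫) ⟪e, ξ⟫ t := by
      simp only [inner_add_left, real_inner_smul_left]
      simpa using ((hasDerivAt_id t).mul_const ⟪e, ξ⟫).const_add ⟪x, ξ⟫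
    have h2 := ((h1.ofReal_comp.const_mul Complex.I).cexp).mul_const (g ξ)
    refine HasDerivAt.congr_deriv h2 ?_
    ring

lemma eLpNorm_two_sq {α : Type*} [MeasurableSpace α] (f : α → ℂ) (μ : Measure α) :
    eLpNorm f 2 μ ^ 2 = ∫⁻ x, ‖f x‖ₑ ^ 2 ∂μ := by
  have := eLpNorm_nnreal_pow_eq_lintegral (f := f) (μ := μ) (p := 2) (by norm_num)
  simpa using this

lemma invFt_sub (f g : E2 → ℂ) (hf : Integrable f) (hg : Integrable g) :
    invFt (f - g) = invFt f - invFt g := by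
  have hnorm : ∀ r : ℝ, ‖Complex.exp (Complex.I * (r : ℂ))‖ = 1 := fun r => by
    rw [mul_comm]; exact Complex.norm_exp_ofReal_mul_I r
  have hIntg : ∀ (y : E2) (q : E2 → ℂ), Integrable q volume →
      Integrable (fun ξ => Complex.exp (Complex.I * ((⟪y, ξ⟫ : ℝ) : ℂ)) * q ξ) volume := by
    intro y q hq
    refine hq.mono (AEStronglyMeasurable.mul (Continuous.aestronglyMeasurable ?_) hq.1)
      (ae_of_all _ fun ξ => ?_)
    · fun_prop
    · rw [norm_mul, hnorm, one_mul]
  ext x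
  simp only [invFt, Pi.sub_apply, mul_sub]
  rw [integral_sub (hIntg _ _ hf) (hIntg _ _ hg), smul_sub]

lemma invFt_norm_le (g : E2 → ℂ) (x : E2) : ‖invFt g x‖ ≤ ∫ ξ, ‖g ξ‖ := by
  have hnorm : ∀ r : ℝ, ‖Complex.exp (Complex.I * (r : ℂ))‖ = 1 := fun r => by
    rw [mul_comm]; exact Complex.norm_exp_ofReal_mul_I r
  unfold invFt
  rw [norm_smul]
  have h1 : ‖(((2 * Real.pi) ^ 2)⁻¹ : ℝ)‖ ≤ 1 := by
    rw [Real.norm_of_nonneg (by positivity)]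
    apply inv_le_one_of_one_le₀
    nlinarith [Real.pi_gt_three]
  calc _ ≤ 1 * ‖∫ ξ : E2, Complex.exp (Complex.I * ((⟪x, ξ⟫ : ℝ) : ℂ)) * g ξ‖ := by gcongr
    _ ≤ ∫ ξ, ‖Complex.exp (Complex.I * ((⟪x, ξ⟫ : ℝ) : ℂ)) * g ξ‖ := by
      rw [one_mul]; exact norm_integral_le_integral_norm _
    _ = _ := by simp only [norm_mul, hnorm, one_mul]

lemma exists_L2_limit (q : E2 → ℂ) (qk : ℕ → E2 → ℂ) (hq : MemLp q 2)
    (hk1 : ∀ k, Integrable (qk k)) (hk2 : ∀ k, MemLp (qk k) 2)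
    (hlim : Tendsto (fun k => eLpNorm (qk k - q) 2 volume) atTop (𝓝 0)) :
    ∃ W : E2 → ℂ, StronglyMeasurable W ∧ MemLp W 2 ∧ eLpNorm W 2 volume ≤ eLpNorm q 2 volume ∧
      Tendsto (fun k => eLpNorm (invFt (qk k) - W) 2 volume) atTop (𝓝 0) := by
  have hM : ∀ k, MemLp (invFt (qk k)) 2 := fun k =>
    ⟨(invFt_continuous _ (hk1 k)).aestronglyMeasurable,
      (invFt_plancherel _ (hk1 k) (hk2 k)).trans_lt (hk2 k).2⟩
  let Qk : ℕ → Lp ℂ 2 (volume : Measure E2) := fun k => (hk2 k).toLp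
  let Q : Lp ℂ 2 (volume : Measure E2) := hq.toLp
  let Wk : ℕ → Lp ℂ 2 (volume : Measure E2) := fun k => (hM k).toLp
  have hQ : Tendsto Qk atTop (𝓝 Q) :=
    (Lp.tendsto_Lp_iff_tendsto_eLpNorm'' _ hk2 _ hq).2 hlim
  have hd : ∀ k l, dist (Wk k) (Wk l) ≤ dist (Qk k) (Qk l) := by
    intro k l
    rw [dist_eq_norm, dist_eq_norm, ← MemLp.toLp_sub, ← MemLp.toLp_sub, Lp.norm_toLp, Lp.norm_toLp]
    apply ENNReal.toReal_mono ((hk2 k).sub (hk2 l)).2.ne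
    rw [← invFt_sub _ _ (hk1 k) (hk1 l)]
    exact invFt_plancherel _ ((hk1 k).sub (hk1 l)) ((hk2 k).sub (hk2 l))
  have hn : ∀ k, ‖Wk k‖ ≤ ‖Qk k‖ := by
    intro k
    rw [Lp.norm_toLp, Lp.norm_toLp]
    exact ENNReal.toReal_mono (hk2 k).2.ne (invFt_plancherel _ (hk1 k) (hk2 k))
  have hC : CauchySeq Wk := by
    have := hQ.cauchySeq
    rw [Metric.cauchySeq_iff] at this ⊢
    intro ε hε
    obtain ⟨n, hn⟩ := this ε hε
    exact ⟨n, fun a ha b hb => (hd a b).trans_lt (hn a ha b hb)⟩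
  obtain ⟨W, hW⟩ := cauchySeq_tendsto_of_complete hC
  refine ⟨W, Lp.stronglyMeasurable W, Lp.memLp W, ?_, ?_⟩
  · have h1 : ‖W‖ ≤ ‖Q‖ := le_of_tendsto_of_tendsto' hW.norm hQ.norm hn
    rw [Lp.norm_def, Lp.norm_toLp] at h1
    exact (ENNReal.toReal_le_toReal (Lp.eLpNorm_ne_top _) hq.2.ne).1 h1
  · have h2 := (Lp.tendsto_Lp_iff_tendsto_eLpNorm' _ _).1 hW
    refine h2.congr fun k => eLpNorm_congr_ae ?_
    filter_upwards [(hM k).coeFn_toLp] with x hx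
    simp only [Pi.sub_apply]
    rw [hx]

lemma slices_tendsto (e : E2) (V : ℕ → E2 → ℂ) (hV : ∀ k, StronglyMeasurable (V k))
    (hlim : Tendsto (fun k => eLpNorm (V k) 2 volume) atTop (𝓝 0)) :
    ∃ φ : ℕ → ℕ, StrictMono φ ∧ ∀ᵐ x : E2, Tendsto (fun k =>
      eLpNorm (fun y : ℝ => V (φ k) (x + y • e)) 1 (volume.restrict (Icc (-1) 1))) atTop (𝓝 0) := by
  have hlim2 : Tendsto (fun k => eLpNorm (V k) 2 volume ^ 2) atTop (𝓝 0) := by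
    simpa using ENNReal.Tendsto.pow (n := 2) hlim
  have hev : ∀ n : ℕ, ∀ᶠ k in atTop, eLpNorm (V k) 2 volume ^ 2 < (2⁻¹ : ℝ≥0∞) ^ n := by
    intro n
    exact hlim2.eventually_lt_const (by
      exact ENNReal.pow_pos (by norm_num) n)
  obtain ⟨φ, hφ, hφ2⟩ := extraction_forall_of_eventually hev
  refine ⟨φ, hφ, ?_⟩
  let Φ : ℕ → E2 → ℝ≥0∞ := fun k x => ∫⁻ y in Icc (-1:ℝ) 1, ‖V (φ k) (x + y • e)‖ₑ ^ 2
  have hjm : ∀ k, Measurable (fun p : E2 × ℝ => ‖V (φ k) (p.1 + p.2 • e)‖ₑ ^ 2) := by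
    intro k
    have : Measurable (fun p : E2 × ℝ => V (φ k) (p.1 + p.2 • e)) :=
      (hV (φ k)).measurable.comp (by fun_prop)
    exact this.enorm.pow_const 2
  have hΦm : ∀ k, Measurable (Φ k) := fun k => (hjm k).lintegral_prod_right'
  have hΦ : ∀ k, ∫⁻ x, Φ k x = 2 * eLpNorm (V (φ k)) 2 volume ^ 2 := by
    intro k
    simp only [Φ]
    rw [lintegral_lintegral_swap (hjm k).aemeasurable]
    have : ∀ y : ℝ, ∫⁻ x, ‖V (φ k) (x + y • e)‖ₑ ^ 2 = eLpNorm (V (φ k)) 2 volume ^ 2 := by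
      intro y
      rw [eLpNorm_two_sq]
      exact lintegral_add_right_eq_self (fun x => ‖V (φ k) x‖ₑ ^ 2) (y • e)
    simp only [this, lintegral_const, Measure.restrict_apply MeasurableSet.univ, univ_inter,
      Real.volume_Icc]
    rw [mul_comm]; norm_num
  have hsum : ∫⁻ x, ∑' k, Φ k x ≠ ⊤ := by
    rw [lintegral_tsum fun k => (hΦm k).aemeasurable]
    have : ∑' k, ∫⁻ x, Φ k x ≤ ∑' k : ℕ, 2 * (2⁻¹ : ℝ≥0∞) ^ k := by
      refine ENNReal.tsum_le_tsum fun k => ?_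
      rw [hΦ]
      exact mul_le_mul' le_rfl (hφ2 k).le
    refine (this.trans_lt ?_).ne
    rw [ENNReal.tsum_mul_left, ENNReal.tsum_geometric]
    norm_num
  have hae := ae_lt_top (Measurable.tsum hΦm) hsum
  filter_upwards [hae] with x hx
  have h0 : Tendsto (fun k => Φ k x) atTop (𝓝 0) := ENNReal.tendsto_atTop_zero_of_tsum_ne_top hx.ne
  have h1 : Tendsto (fun k => eLpNorm (fun y : ℝ => V (φ k) (x + y • e)) 2
      (volume.restrict (Icc (-1) 1))) atTop (𝓝 0) := by
    have := h0.ennrpow_const (1/2 : ℝ)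
    rw [ENNReal.zero_rpow_of_pos (by norm_num)] at this
    refine this.congr fun k => ?_
    simp only [Φ]
    rw [← eLpNorm_two_sq, ← ENNReal.rpow_natCast, ← ENNReal.rpow_mul]
    norm_num
  have h2 := ENNReal.Tendsto.mul_const (b := (volume.restrict (Icc (-1:ℝ) 1) univ) ^ (1/2 : ℝ)) h1
    (Or.inr (by
      rw [Measure.restrict_apply MeasurableSet.univ, univ_inter, Real.volume_Icc]
      exact (ENNReal.rpow_lt_top_of_nonneg (by norm_num) ENNReal.ofReal_ne_top).ne))
  rw [zero_mul] at h2
  refine tendsto_of_tendsto_of_tendsto_of_le_of_le tendsto_const_nhds h2 (fun _ => zero_le) ?_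
  intro k
  have := eLpNorm_le_eLpNorm_mul_rpow_measure_univ (p := 1) (q := 2)
    (μ := volume.restrict (Icc (-1:ℝ) 1))
    (f := fun y : ℝ => V (φ k) (x + y • e)) (by norm_num)
    ((hV (φ k)).comp_measurable (by fun_prop)).aestronglyMeasurable
  refine this.trans_eq ?_
  norm_num

lemma oneD_limit (φ φ' w : ℕ → ℝ → ℂ) (f W : ℝ → ℂ)
    (h1 : ∀ k t, HasDerivAt (φ k) (φ' k t) t) (h2 : ∀ k t, HasDerivAt (φ' k) (w k t) t)
    (hw : ∀ k, Continuous (w k)) (hf : ∀ t, Tendsto (fun k => φ k t) atTop (𝓝 (f t)))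
    (hW : IntegrableOn W (Icc (-1) 1))
    (hlim : Tendsto (fun k => eLpNorm (fun y => w k y - W y) 1 (volume.restrict (Icc (-1) 1)))
      atTop (𝓝 0)) :
    ∃ c : ℂ, ∀ t ∈ Ioo (-1:ℝ) 1, HasDerivAt f (c + ∫ y in (0:ℝ)..t, W y) t := by
  have hIntg : ∀ k, IntegrableOn (fun y => w k y - W y) (Icc (-1) 1) := fun k =>
    ((hw k).continuousOn.integrableOn_Icc).sub hW
  let δ : ℕ → ℝ := fun k => ∫ y in Icc (-1:ℝ) 1, ‖w k y - W y‖
  have hδ : Tendsto δ atTop (𝓝 0) := by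
    have := (ENNReal.tendsto_toReal ENNReal.zero_ne_top).comp hlim
    refine this.congr fun k => ?_
    simp only [Function.comp, δ]
    rw [eLpNorm_one_eq_lintegral_enorm, integral_norm_eq_lintegral_enorm (hIntg k).1]
  have hsub : ∀ t ∈ Icc (-1:ℝ) 1, uIcc 0 t ⊆ Icc (-1) 1 := fun t ht =>
    uIcc_subset_Icc (by norm_num) ht
  have hWi : ∀ t ∈ Icc (-1:ℝ) 1, IntervalIntegrable W volume 0 t := fun t ht =>
    (hW.mono_set (hsub t ht)).intervalIntegrable
  have hΓ : ∀ k, ∀ t ∈ Icc (-1:ℝ) 1,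
      ‖(∫ y in (0:ℝ)..t, w k y) - ∫ y in (0:ℝ)..t, W y‖ ≤ δ k := by
    intro k t ht
    rw [← intervalIntegral.integral_sub ((hw k).intervalIntegrable _ _) (hWi t ht)]
    refine intervalIntegral.norm_integral_le_integral_norm_uIoc.trans ?_
    refine setIntegral_mono_set (hIntg k).norm (ae_of_all _ fun _ => norm_nonneg _) ?_
    exact (uIoc_subset_uIcc.trans (hsub t ht)).eventuallyLE
  have hφ' : ∀ k t, φ' k t = φ' k 0 + ∫ y in (0:ℝ)..t, w k y := by
    intro k t
    rw [intervalIntegral.integral_eq_sub_of_hasDerivAt (fun x _ => h2 k x)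
      ((hw k).intervalIntegrable _ _)]
    ring
  have hΓc : ContinuousOn (fun t => ∫ y in (0:ℝ)..t, W y) (Icc (-1) 1) := by
    have := intervalIntegral.continuousOn_primitive_interval' (f := W) (μ := volume) (a := 0)
      (b₁ := -1) (b₂ := 1) (by
        rw [intervalIntegrable_iff_integrableOn_Icc_of_le (by norm_num)]; exact hW)
        (by rw [uIcc_of_le (by norm_num)]; constructor <;> norm_num)
    rwa [uIcc_of_le (by norm_num)] at this
  have hΓkc : ∀ k, Continuous (fun t => ∫ y in (0:ℝ)..t, w k y) := fun k =>
    intervalIntegral.continuous_primitive (fun a b => (hw k).intervalIntegrable a b) 0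
  have hΓi : IntervalIntegrable (fun t => ∫ y in (0:ℝ)..t, W y) volume 0 1 := by
    apply ContinuousOn.intervalIntegrable
    rw [uIcc_of_le (by norm_num)]
    exact hΓc.mono (Icc_subset_Icc (by norm_num) le_rfl)
  have hc : ∀ k, φ' k 0 = φ k 1 - φ k 0 - ∫ t in (0:ℝ)..1, ∫ y in (0:ℝ)..t, w k y := by
    intro k
    have hφ'c : Continuous (φ' k) := by
      rw [continuous_iff_continuousAt]; exact fun t => (h2 k t).continuousAt
    have := intervalIntegral.integral_eq_sub_of_hasDerivAt (a := 0) (b := 1) (fun x _ => h1 k x)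
      (hφ'c.intervalIntegrable _ _)
    rw [← this]
    rw [intervalIntegral.integral_congr
      (g := fun t => φ' k 0 + ∫ y in (0:ℝ)..t, w k y) (fun t _ => hφ' k t)]
    rw [intervalIntegral.integral_add (by simp) ((hΓkc k).intervalIntegrable _ _)]
    simp
  let c : ℂ := f 1 - f 0 - ∫ t in (0:ℝ)..1, ∫ y in (0:ℝ)..t, W y
  have hcl : Tendsto (fun k => φ' k 0) atTop (𝓝 c) := by
    simp_rw [hc]
    refine ((hf 1).sub (hf 0)).sub ?_
    rw [tendsto_iff_norm_sub_tendsto_zero]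
    refine squeeze_zero (fun _ => norm_nonneg _) (fun k => ?_) hδ
    rw [← intervalIntegral.integral_sub ((hΓkc k).intervalIntegrable _ _) hΓi]
    have := intervalIntegral.norm_integral_le_of_norm_le_const (a := 0) (b := 1) (C := δ k)
      (f := fun t => (∫ y in (0:ℝ)..t, w k y) - ∫ y in (0:ℝ)..t, W y) (fun t ht => by
        rw [uIoc_of_le (by norm_num)] at ht
        exact hΓ k t ⟨by linarith [ht.1], ht.2⟩)
    simpa using this
  refine ⟨c, fun t ht => ?_⟩
  refine hasDerivAt_of_tendstoUniformlyOn (l := atTop) (f := φ) (f' := φ')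
    (g' := fun t => c + ∫ y in (0:ℝ)..t, W y) isOpen_Ioo ?_
    (Eventually.of_forall fun k t _ => h1 k t) (fun t _ => hf t) ht
  rw [Metric.tendstoUniformlyOn_iff]
  intro ε hε
  have e1 := (tendsto_iff_norm_sub_tendsto_zero.1 hcl).add hδ
  rw [add_zero] at e1
  filter_upwards [e1.eventually_lt_const hε] with k hk t ht
  rw [dist_comm, dist_eq_norm, hφ']
  refine lt_of_le_of_lt ?_ hk
  have : φ' k 0 + (∫ y in (0:ℝ)..t, w k y) - (c + ∫ y in (0:ℝ)..t, W y)
    = (φ' k 0 - c) + ((∫ y in (0:ℝ)..t, w k y) - ∫ y in (0:ℝ)..t, W y) := by ring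
  rw [this]
  exact (norm_add_le _ _).trans (add_le_add le_rfl (hΓ k t ⟨ht.1.le, ht.2.le⟩))

/-- Derivative alternative. -/
lemma deriv_alternative (g Γ : ℝ → ℂ) (t : ℝ) (d w : ℂ) (hg : HasDerivAt g d t)
    (hΓ : HasDerivAt Γ w t) (h : ∀ᶠ s in 𝓝 t, g s = Γ s ∨ g s = 0) : d = w ∨ d = 0 := by
  have key : ∀ (k : ℝ → ℂ) (v : ℂ), HasDerivAt k v t → (∃ᶠ s in 𝓝[≠] t, g s = k s) → d = v := by
    intro k v hk hfr
    have hd : HasDerivAt (fun s => g s - k s) (d - v) t := hg.sub hk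
    have h0 : g t - k t = 0 := by
      by_contra hne
      have := (hd.continuousAt.eventually_ne hne).filter_mono (nhdsWithin_le_nhds (s := {t}ᶜ))
      obtain ⟨s, hs1, hs2⟩ := (hfr.and_eventually this).exists
      exact hs2 (by simp [hs1])
    have := hasDerivAt_iff_tendsto_slope.1 hd
    by_contra hne
    have hev := this.eventually_ne (sub_ne_zero.2 hne)
    obtain ⟨s, hs1, hs2⟩ := (hfr.and_eventually hev).exists
    apply hs2
    rw [slope_def_module, h0, hs1]
    simp
  by_cases hfr : ∃ᶠ s in 𝓝[≠] t, g s = Γ s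
  · exact Or.inl (key Γ w hΓ hfr)
  · right
    refine key (fun _ => 0) 0 (hasDerivAt_const t 0) ?_
    apply Eventually.frequently
    filter_upwards [not_frequently.1 hfr, h.filter_mono nhdsWithin_le_nhds] with s hs1 hs2
    exact hs2.resolve_left hs1

lemma cutoff_tendsto (q : E2 → ℂ) (hq : MemLp q 2) :
    Tendsto (fun k : ℕ => eLpNorm ((Metric.closedBall (0:E2) k).indicator q - q) 2 volume)
      atTop (𝓝 0) := by
  have hsq : ∫⁻ x, ‖q x‖ₑ ^ 2 ≠ ⊤ := by
    rw [← eLpNorm_two_sq]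
    exact ENNReal.pow_ne_top hq.2.ne
  have h0 : Tendsto (fun k : ℕ => ∫⁻ x, ‖((Metric.closedBall (0:E2) k).indicator q - q) x‖ₑ ^ 2)
      atTop (𝓝 (∫⁻ _ : E2, 0)) := by
    refine tendsto_lintegral_of_dominated_convergence' (fun x => ‖q x‖ₑ ^ 2) ?_ ?_ hsq ?_
    · intro k
      exact (((hq.1.indicator Metric.isClosed_closedBall.measurableSet).sub hq.1).enorm).pow_const 2
    · intro k
      refine ae_of_all _ fun x => ?_
      by_cases hx : x ∈ Metric.closedBall (0:E2) k
      · simp [Set.indicator_of_mem hx]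
      · simp [Set.indicator_of_notMem hx]
    · refine ae_of_all _ fun x => ?_
      refine tendsto_const_nhds.congr' ?_
      obtain ⟨n, hn⟩ := exists_nat_ge ‖x‖
      filter_upwards [eventually_ge_atTop n] with k hk
      have hx : x ∈ Metric.closedBall (0:E2) k := by
        rw [mem_closedBall_zero_iff]
        exact hn.trans (by exact_mod_cast hk)
      simp [Set.indicator_of_mem hx]
  rw [lintegral_zero] at h0
  have := h0.ennrpow_const (1/2 : ℝ)
  rw [ENNReal.zero_rpow_of_pos (by norm_num)] at this
  refine this.congr fun k => ?_
  rw [← eLpNorm_two_sq, ← ENNReal.rpow_natCast, ← ENNReal.rpow_mul]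
  norm_num

lemma slice_structure (h : E2 → ℂ) (hh : Integrable h) (e : E2)
    (hq : MemLp (fun ξ => ((⟪e, ξ⟫ : ℝ) : ℂ) ^ 2 * h ξ) 2) :
    ∃ W : E2 → ℂ, StronglyMeasurable W ∧ MemLp W 2 ∧
      eLpNorm W 2 volume ≤ eLpNorm (fun ξ => ((⟪e, ξ⟫ : ℝ) : ℂ) ^ 2 * h ξ) 2 volume ∧
      ∀ᵐ x : E2, IntegrableOn (fun y : ℝ => W (x + y • e)) (Icc (-1) 1) ∧
        ∃ c : ℂ, ∀ t ∈ Ioo (-1:ℝ) 1, HasDerivAt (fun t : ℝ => invFt h (x + t • e))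
          (c + ∫ y in (0:ℝ)..t, W (x + y • e)) t := by
  let g : ℕ → E2 → ℂ := fun k => (Metric.closedBall (0:E2) k).indicator h
  let g1 : ℕ → E2 → ℂ := fun k ξ => Complex.I * ((⟪e, ξ⟫ : ℝ) : ℂ) * g k ξ
  let g2 : ℕ → E2 → ℂ := fun k ξ => Complex.I * ((⟪e, ξ⟫ : ℝ) : ℂ) * g1 k ξ
  let q : E2 → ℂ := -(fun ξ => ((⟪e, ξ⟫ : ℝ) : ℂ) ^ 2 * h ξ)
  have hq' : MemLp q 2 := hq.neg
  have hg2q : ∀ k, g2 k = (Metric.closedBall (0:E2) k).indicator q := by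
    intro k
    ext ξ
    by_cases hx : ξ ∈ Metric.closedBall (0:E2) k
    · simp only [g2, g1, g, q, Set.indicator_of_mem hx, Pi.neg_apply]
      linear_combination (((⟪e, ξ⟫ : ℝ) : ℂ) ^ 2 * h ξ) * Complex.I_sq
    · simp only [g2, g1, g, q, Set.indicator_of_notMem hx, mul_zero]
  have hg : ∀ k, Integrable (g k) := fun k => hh.indicator Metric.isClosed_closedBall.measurableSet
  have hstep : ∀ (k : ℕ) (p : E2 → ℂ), Integrable p → (∀ ξ, ξ ∉ Metric.closedBall (0:E2) k → p ξ = 0)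
      → Integrable (fun ξ => Complex.I * ((⟪e, ξ⟫ : ℝ) : ℂ) * p ξ) := by
    intro k p hp hsupp
    refine (hp.norm.const_mul (‖e‖ * k)).mono' ?_ (ae_of_all _ fun ξ => ?_)
    · refine AEStronglyMeasurable.mul (Continuous.aestronglyMeasurable ?_) hp.1
      fun_prop
    · by_cases hx : ξ ∈ Metric.closedBall (0:E2) k
      · rw [norm_mul, norm_mul, Complex.norm_I, one_mul, Complex.norm_real]
        gcongr
        refine (norm_inner_le_norm _ _).trans ?_
        rw [mem_closedBall_zero_iff] at hx
        gcongr
      · rw [hsupp ξ hx]; simp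
  have hgs : ∀ k : ℕ, ∀ ξ, ξ ∉ Metric.closedBall (0:E2) k → g k ξ = 0 := fun k ξ hx =>
    Set.indicator_of_notMem hx _
  have hg1 : ∀ k, Integrable (g1 k) := fun k => hstep k _ (hg k) (hgs k)
  have hg2 : ∀ k, Integrable (g2 k) := fun k => hstep k _ (hg1 k) (fun ξ hx => by
    simp only [g1]; rw [hgs k ξ hx, mul_zero])
  have hg2m : ∀ k, MemLp (g2 k) 2 := fun k => by
    rw [hg2q]; exact hq'.indicator Metric.isClosed_closedBall.measurableSet
  obtain ⟨W, hWm, hWL, hWn, hWlim⟩ := exists_L2_limit q g2 hq' hg2 hg2m (by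
    simp_rw [hg2q]; exact cutoff_tendsto q hq')
  refine ⟨W, hWm, hWL, ?_, ?_⟩
  · rwa [eLpNorm_neg] at hWn
  have hc2 : ∀ k, Continuous (invFt (g2 k)) := fun k => invFt_continuous _ (hg2 k)
  obtain ⟨φ, hφ, hae⟩ := slices_tendsto e (fun k => invFt (g2 k) - W)
    (fun k => (hc2 k).stronglyMeasurable.sub hWm) hWlim
  have hpt : ∀ x, Tendsto (fun k => invFt (g k) x) atTop (𝓝 (invFt h x)) := by
    intro x
    have hnorm : ∀ r : ℝ, ‖Complex.exp (Complex.I * (r : ℂ))‖ = 1 := fun r => by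
      rw [mul_comm]; exact Complex.norm_exp_ofReal_mul_I r
    unfold invFt
    refine Tendsto.const_smul ?_ _
    refine tendsto_integral_of_dominated_convergence (fun ξ => ‖h ξ‖) ?_ hh.norm ?_ ?_
    · intro k
      refine AEStronglyMeasurable.mul (Continuous.aestronglyMeasurable ?_) (hg k).1
      fun_prop
    · intro k
      refine ae_of_all _ fun ξ => ?_
      rw [norm_mul, hnorm, one_mul]
      exact norm_indicator_le_norm_self _ _
    · refine ae_of_all _ fun ξ => ?_
      refine tendsto_const_nhds.congr' ?_
      obtain ⟨n, hn⟩ := exists_nat_ge ‖ξ‖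
      filter_upwards [eventually_ge_atTop n] with k hk
      have hx : ξ ∈ Metric.closedBall (0:E2) k := by
        rw [mem_closedBall_zero_iff]
        exact hn.trans (by exact_mod_cast hk)
      simp [g, Set.indicator_of_mem hx]
  filter_upwards [hae] with x hx
  have hcl : ∀ k, Continuous (fun y : ℝ => invFt (g2 (φ k)) (x + y • e)) := fun k =>
    (hc2 (φ k)).comp (by fun_prop)
  have hWi : IntegrableOn (fun y : ℝ => W (x + y • e)) (Icc (-1) 1) := by
    obtain ⟨k, hk⟩ := (hx.eventually_lt_const (u := 1) (by norm_num)).exists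
    have h1 : IntegrableOn (fun y : ℝ => (invFt (g2 (φ k)) - W) (x + y • e)) (Icc (-1) 1) := by
      rw [IntegrableOn, ← memLp_one_iff_integrable]
      exact ⟨(((hc2 _).stronglyMeasurable.sub hWm).comp_measurable
        (by fun_prop)).aestronglyMeasurable, hk.trans (by norm_num)⟩
    have h2 : IntegrableOn (fun y : ℝ => invFt (g2 (φ k)) (x + y • e)) (Icc (-1) 1) :=
      (hcl k).continuousOn.integrableOn_Icc
    refine (h2.sub h1).congr (ae_of_all _ fun y => ?_)
    simp
  refine ⟨hWi, ?_⟩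
  exact oneD_limit (fun k t => invFt (g (φ k)) (x + t • e)) (fun k t => invFt (g1 (φ k)) (x + t • e))
    (fun k t => invFt (g2 (φ k)) (x + t • e)) (fun t => invFt h (x + t • e))
    (fun t => W (x + t • e))
    (fun k t => invFt_hasDerivAt _ (hg _) e x (hg1 _) t)
    (fun k t => invFt_hasDerivAt _ (hg1 _) e x (hg2 _) t) hcl
    (fun t => (hpt _).comp hφ.tendsto_atTop) hWi hx

lemma second_deriv_bound (h : E2 → ℂ) (hh : Integrable h) (e : E2)
    (hq : MemLp (fun ξ => ((⟪e, ξ⟫ : ℝ) : ℂ) ^ 2 * h ξ) 2) :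
    ∃ W : E2 → ℂ, MemLp W 2 ∧
      eLpNorm W 2 volume ≤ eLpNorm (fun ξ => ((⟪e, ξ⟫ : ℝ) : ℂ) ^ 2 * h ξ) 2 volume ∧
      ∀ᵐ x : E2, ‖fderiv ℝ (fun y => fderiv ℝ (invFt h) y e) x e‖ ≤ ‖W x‖ := by
  obtain ⟨W, hWm, hWL, hWn, hae⟩ := slice_structure h hh e hq
  refine ⟨W, hWL, hWn, ?_⟩
  let G : E2 → ℂ := fun y => fderiv ℝ (invFt h) y e
  have hline : ∀ (F : E2 → ℂ) (x : E2) (t : ℝ), DifferentiableAt ℝ F (x + t • e) →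
      HasDerivAt (fun s : ℝ => F (x + s • e)) (fderiv ℝ F (x + t • e) e) t := by
    intro F x t hF
    have h1 : HasDerivAt (fun s : ℝ => x + s • e) e t := by
      simpa using ((hasDerivAt_id t).smul_const e).const_add x
    exact hF.hasFDerivAt.comp_hasDerivAt t h1
  have hmain : ∀ᵐ x : E2, ∀ᵐ t ∂(volume.restrict (Ioo (-1:ℝ) 1)),
      ‖fderiv ℝ G (x + t • e) e‖ ≤ ‖W (x + t • e)‖ := by
    filter_upwards [hae] with x hx
    obtain ⟨hWi, c, hc⟩ := hx
    have hL := IntervalIntegrable.ae_hasDerivAt_integral (a := -1) (b := 1)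
      ((intervalIntegrable_iff_integrableOn_Icc_of_le (by norm_num)).2 hWi)
    rw [ae_restrict_iff' measurableSet_Ioo]
    filter_upwards [hL] with t hLt ht
    by_cases hd : DifferentiableAt ℝ G (x + t • e)
    · rw [uIcc_of_le (by norm_num)] at hLt
      have hΓ := (hLt ⟨ht.1.le, ht.2.le⟩ 0 (by constructor <;> norm_num)).const_add c
      have := deriv_alternative (fun s : ℝ => G (x + s • e))
        (fun s : ℝ => c + ∫ y in (0:ℝ)..s, W (x + y • e)) t _ _ (hline G x t hd) hΓ (by
          filter_upwards [isOpen_Ioo.mem_nhds ht] with s hs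
          by_cases hds : DifferentiableAt ℝ (invFt h) (x + s • e)
          · left
            exact (hline _ x s hds).unique (hc s hs)
          · right
            simp only [G]
            rw [fderiv_zero_of_not_differentiableAt hds]
            simp)
      rcases this with h1 | h1
      · rw [h1]
      · rw [h1]; simp
    · rw [fderiv_zero_of_not_differentiableAt hd]; simp
  have hmeasS : MeasurableSet {x : E2 | ‖fderiv ℝ G x e‖ ≤ ‖W x‖} :=
    measurableSet_le (measurable_fderiv_apply_const ℝ G e).norm hWm.measurable.norm
  have hmeas : MeasurableSet {p : E2 × ℝ | ‖fderiv ℝ G (p.1 + p.2 • e) e‖ ≤ ‖W (p.1 + p.2 • e)‖} :=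
    hmeasS.preimage (f := fun p : E2 × ℝ => p.1 + p.2 • e) (by fun_prop)
  have hsw := (Measure.ae_ae_comm (μ := (volume : Measure E2)) (ν := volume.restrict (Ioo (-1:ℝ) 1))
    (p := fun x t => ‖fderiv ℝ G (x + t • e) e‖ ≤ ‖W (x + t • e)‖) hmeas).1 hmain
  have : NeBot (ae (volume.restrict (Ioo (-1:ℝ) 1))) := by
    rw [ae_restrict_neBot]
    simp
  obtain ⟨t, ht⟩ := hsw.exists
  have hqmp := (measurePreserving_add_right (volume : Measure E2) (-(t • e))).quasiMeasurePreserving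
  have := hqmp.ae ht
  filter_upwards [this] with x hx
  simpa [G] using hx

lemma integral_sq_eq (f : E2 → ℂ) (hf : AEStronglyMeasurable f volume) :
    ∫ x, ‖f x‖ ^ 2 = (eLpNorm f 2 volume ^ 2).toReal := by
  have hm : AEStronglyMeasurable (fun x => ‖f x‖ ^ 2) volume := hf.norm.pow 2
  rw [eLpNorm_two_sq, integral_eq_lintegral_of_nonneg_ae (ae_of_all _ fun _ => by positivity) hm]
  congr 1
  refine lintegral_congr fun x => ?_
  rw [ENNReal.ofReal_pow (norm_nonneg _), ofReal_norm]

lemma integral_sq_le (f g : E2 → ℂ) (hf : MemLp f 2) (hg : MemLp g 2)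
    (h : eLpNorm f 2 volume ≤ eLpNorm g 2 volume) : ∫ x, ‖f x‖ ^ 2 ≤ ∫ x, ‖g x‖ ^ 2 := by
  rw [integral_sq_eq f hf.1, integral_sq_eq g hg.1]
  apply ENNReal.toReal_mono (ENNReal.pow_ne_top hg.2.ne)
  gcongr

lemma memLp_sq_integrable (f : E2 → ℂ) (hf : MemLp f 2) : Integrable (fun x => ‖f x‖ ^ 2) := by
  have := hf.integrable_norm_pow (by norm_num : (2:ℕ) ≠ 0)
  simpa using this

lemma energy_invFt_le (h : E2 → ℂ) (hh : Integrable h) (h2 : MemLp h 2)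
    (h4 : MemLp (fun ξ => ((‖ξ‖ : ℝ) : ℂ) ^ 2 * h ξ) 2) :
    energy (invFt h) ≤ 2 * (∫ ξ, ‖((‖ξ‖ : ℝ) : ℂ) ^ 2 * h ξ‖ ^ 2) +
      (∫ ξ, ‖h ξ‖) ^ 4 * ∫ ξ, ‖h ξ‖ ^ 2 := by
  let e : Fin 2 → E2 := fun i => EuclideanSpace.single i (1:ℝ)
  have he : ∀ i, ‖e i‖ = 1 := fun i => by simp [e]
  have hpt : ∀ i ξ, ‖((⟪e i, ξ⟫ : ℝ) : ℂ) ^ 2 * h ξ‖ ≤ ‖((‖ξ‖ : ℝ) : ℂ) ^ 2 * h ξ‖ := by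
    intro i ξ
    rw [norm_mul, norm_mul, norm_pow, norm_pow, Complex.norm_real, Complex.norm_real, norm_norm]
    gcongr
    refine (norm_inner_le_norm _ _).trans ?_
    rw [he, one_mul]
  have hq : ∀ i, MemLp (fun ξ => ((⟪e i, ξ⟫ : ℝ) : ℂ) ^ 2 * h ξ) 2 := by
    intro i
    refine h4.of_le ?_ (ae_of_all _ (hpt i))
    refine AEStronglyMeasurable.mul (Continuous.aestronglyMeasurable ?_) h2.1
    fun_prop
  have hex := fun i => second_deriv_bound h hh (e i) (hq i)
  choose W hW hWn hWae using hex
  have hWI : ∀ i, ∫ x, ‖W i x‖ ^ 2 ≤ ∫ ξ, ‖((‖ξ‖ : ℝ) : ℂ) ^ 2 * h ξ‖ ^ 2 := fun i =>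
    integral_sq_le _ _ (hW i) h4 ((hWn i).trans (eLpNorm_mono (hpt i)))
  have hvM : MemLp (invFt h) 2 :=
    ⟨(invFt_continuous _ hh).aestronglyMeasurable, (invFt_plancherel _ hh h2).trans_lt h2.2⟩
  have hvI : ∫ x, ‖invFt h x‖ ^ 2 ≤ ∫ ξ, ‖h ξ‖ ^ 2 :=
    integral_sq_le _ _ hvM h2 (invFt_plancherel _ hh h2)
  set B := ∫ ξ, ‖h ξ‖ with hB
  have hB0 : 0 ≤ B := integral_nonneg fun _ => norm_nonneg _
  have i0 := memLp_sq_integrable _ (hW 0)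
  have i1 := memLp_sq_integrable _ (hW 1)
  have i2 := (memLp_sq_integrable _ hvM).const_mul (B ^ 4)
  have hdom : energy (invFt h) ≤ ∫ x, ((‖W 0 x‖ ^ 2 + ‖W 1 x‖ ^ 2) + B ^ 4 * ‖invFt h x‖ ^ 2) := by
    unfold energy
    refine integral_mono_of_nonneg (ae_of_all _ fun x => ?_) ((i0.add i1).add i2) ?_
    · simp only [energyIntegrand, Pi.zero_apply]; positivity
    filter_upwards [hWae 0, hWae 1] with x hx0 hx1
    simp only [energyIntegrand, lap, Fin.sum_univ_two]
    have n1 := (norm_add_le _ _).trans (add_le_add hx0 hx1)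
    have n2 := pow_le_pow_left₀ (norm_nonneg _) n1 2
    have n3 := invFt_norm_le h x
    have n4 : ‖invFt h x‖ ^ 6 ≤ B ^ 4 * ‖invFt h x‖ ^ 2 := by
      calc ‖invFt h x‖ ^ 6 = ‖invFt h x‖ ^ 4 * ‖invFt h x‖ ^ 2 := by ring
        _ ≤ _ := by gcongr
    have n5 : 0 ≤ ‖invFt h x‖ ^ 6 := by positivity
    have n6 := sq_nonneg (‖W 0 x‖ - ‖W 1 x‖)
    simp only [e] at n2
    nlinarith
  refine hdom.trans ?_
  have i01 : Integrable (fun x => ‖W 0 x‖ ^ 2 + ‖W 1 x‖ ^ 2) := i0.add i1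
  rw [integral_add i01 i2, integral_add i0 i1, integral_const_mul]
  have := hWI 0
  have := hWI 1
  have : B ^ 4 * ∫ x, ‖invFt h x‖ ^ 2 ≤ B ^ 4 * ∫ ξ, ‖h ξ‖ ^ 2 := by gcongr
  linarith

lemma ft_measurable (u : E2 → ℂ) : Measurable (ft u) := by
  by_cases hu : Integrable u
  · have hcont : Continuous (𝓕 u) :=
      VectorFourier.fourierIntegral_continuous Real.continuous_fourierChar
        (by exact continuous_inner) hu
    have : ft u = fun ξ => 𝓕 u ((2 * Real.pi)⁻¹ • ξ) := by
      ext ξ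
      rw [ft, Real.fourier_eq']
      congr 1
      ext x
      rw [smul_eq_mul, real_inner_smul_right]
      congr 2
      have : (Real.pi : ℂ) ≠ 0 := by exact_mod_cast Real.pi_ne_zero
      push_cast
      field_simp
    rw [this]
    exact (hcont.comp (by fun_prop : Continuous fun ξ : E2 => (2 * Real.pi)⁻¹ • ξ)).measurable
  · have : ft u = fun _ => 0 := by
      ext ξ
      unfold ft
      apply integral_undef
      intro hIntg
      apply hu
      have hc : Continuous fun x : E2 => Complex.exp (Complex.I * ((⟪x, ξ⟫ : ℝ) : ℂ)) := by fun_prop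
      have h2 : u = fun x => Complex.exp (Complex.I * ((⟪x, ξ⟫ : ℝ) : ℂ)) *
          (Complex.exp (-Complex.I * ((⟪x, ξ⟫ : ℝ) : ℂ)) * u x) := by
        ext x
        rw [← mul_assoc, ← Complex.exp_add]
        simp
      rw [h2]
      refine hIntg.mono (hc.aestronglyMeasurable.mul hIntg.1) (ae_of_all _ fun x => ?_)
      rw [norm_mul, mul_comm Complex.I, Complex.norm_exp_ofReal_mul_I, one_mul]
    rw [this]
    exact measurable_const

lemma ft_scale (u : E2 → ℂ) (lam : ℝ) (hl : 0 < lam) (ξ : E2) :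
    ft (fun x => (lam : ℂ)⁻¹ * u (lam⁻¹ • x)) ξ = (lam : ℂ) * ft u (lam • ξ) := by
  unfold ft
  have h := Measure.integral_comp_smul (volume : Measure E2)
    (fun y => Complex.exp (-Complex.I * ((⟪y, lam • ξ⟫ : ℝ) : ℂ)) * ((lam : ℂ)⁻¹ * u y)) lam⁻¹
  have hlc : (lam : ℂ) ≠ 0 := by exact_mod_cast hl.ne'
  calc _ = ∫ x : E2, Complex.exp (-Complex.I * ((⟪lam⁻¹ • x, lam • ξ⟫ : ℝ) : ℂ)) *
          ((lam : ℂ)⁻¹ * u (lam⁻¹ • x)) := by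
        congr 1; ext x
        rw [real_inner_smul_left, real_inner_smul_right, inv_mul_cancel_left₀ hl.ne']
    _ = _ := h
    _ = _ := by
      rw [← integral_const_mul, ← integral_smul]
      congr 1; ext y
      simp only [finrank_euclideanSpace, Fintype.card_fin, inv_pow, inv_inv]
      rw [abs_of_pos (by positivity), Complex.real_smul]
      push_cast
      field_simp

lemma mult_bound (s N : ℝ) (hs₁ : 8/7 < s) (hs₂ : s < 2) (hN : 1 ≤ N) (Cd : ℕ → ℝ) (m : E2 → ℝ)
    (hm : IsIMult s N Cd m) (ξ : E2) : ‖ξ‖ ^ 2 * m ξ ≤ 2 * N ^ (2 - s) * ‖ξ‖ ^ s := by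
  by_cases h0 : ξ = 0
  · subst h0
    simp only [norm_zero]
    rw [Real.zero_rpow (by linarith)]
    simp
  have hpos : 0 < ‖ξ‖ := norm_pos_iff.2 h0
  have hN0 : 0 < N := by linarith
  have hsplit : ‖ξ‖ ^ 2 = ‖ξ‖ ^ (2 - s) * ‖ξ‖ ^ s := by
    rw [← Real.rpow_add hpos]; norm_num
  have hkey : ‖ξ‖ ^ (2 - s) * m ξ ≤ 2 * N ^ (2 - s) := by
    by_cases hc : ‖ξ‖ ≤ 2 * N
    · calc ‖ξ‖ ^ (2 - s) * m ξ ≤ ‖ξ‖ ^ (2 - s) * 1 := by gcongr; exact hm.le_one ξ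
        _ ≤ (2 * N) ^ (2 - s) := by
          rw [mul_one]; exact Real.rpow_le_rpow hpos.le hc (by linarith)
        _ = 2 ^ (2 - s) * N ^ (2 - s) := Real.mul_rpow (by norm_num) hN0.le
        _ ≤ 2 * N ^ (2 - s) := by
          gcongr
          calc (2:ℝ) ^ (2 - s) ≤ 2 ^ (1:ℝ) :=
                Real.rpow_le_rpow_of_exponent_le (by norm_num) (by linarith)
            _ = 2 := by norm_num
    · rw [hm.eq_rpow ξ (not_le.1 hc).le, Real.div_rpow hpos.le hN0.le]
      have e1 : ‖ξ‖ ^ (2 - s) * (‖ξ‖ ^ (s - 2) / N ^ (s - 2)) = N ^ (2 - s) := by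
        rw [mul_div_assoc', ← Real.rpow_add hpos, show 2 - s + (s - 2) = 0 by ring, Real.rpow_zero,
          one_div, ← Real.rpow_neg hN0.le]
        congr 1; ring
      rw [e1]
      have : 0 < N ^ (2 - s) := by positivity
      linarith
  calc ‖ξ‖ ^ 2 * m ξ = (‖ξ‖ ^ (2 - s) * m ξ) * ‖ξ‖ ^ s := by rw [hsplit]; ring
    _ ≤ _ := by gcongr

lemma Hs_integrable (s : ℝ) (u : E2 → ℂ) (hu : HsNorm s u < ⊤) :
    Integrable (fun ξ : E2 => (1 + ‖ξ‖ ^ 2) ^ s * ‖ft u ξ‖ ^ 2) ∧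
      ∫ ξ : E2, (1 + ‖ξ‖ ^ 2) ^ s * ‖ft u ξ‖ ^ 2 = (HsNorm s u).toReal ^ 2 := by
  have hmeas : Measurable (fun ξ : E2 => (1 + ‖ξ‖ ^ 2) ^ s * ‖ft u ξ‖ ^ 2) := by
    have := ft_measurable u
    fun_prop
  have h0 : ∀ ξ : E2, 0 ≤ (1 + ‖ξ‖ ^ 2) ^ s * ‖ft u ξ‖ ^ 2 := fun ξ => by positivity
  have hsq : HsNorm s u ^ 2 =
      ∫⁻ ξ : E2, ENNReal.ofReal ((1 + ‖ξ‖ ^ 2) ^ s * ‖ft u ξ‖ ^ 2) := by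
    unfold HsNorm
    rw [← ENNReal.rpow_natCast, ← ENNReal.rpow_mul]
    norm_num
  have hfin : ∫⁻ ξ : E2, ENNReal.ofReal ((1 + ‖ξ‖ ^ 2) ^ s * ‖ft u ξ‖ ^ 2) < ⊤ := by
    rw [← hsq]; exact ENNReal.pow_lt_top hu
  refine ⟨⟨hmeas.aestronglyMeasurable, ?_⟩, ?_⟩
  · rw [hasFiniteIntegral_iff_ofReal (ae_of_all _ h0)]
    exact hfin
  · rw [integral_eq_lintegral_of_nonneg_ae (ae_of_all _ h0) hmeas.aestronglyMeasurable, ← hsq,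
      ENNReal.toReal_pow]

lemma weight_integrable (s : ℝ) (hs : 1 < s) :
    Integrable (fun ξ : E2 => (1 + ‖ξ‖ ^ 2) ^ (-s)) := by
  have := integrable_rpow_neg_one_add_norm_sq (E := E2) (μ := volume) (r := 2 * s)
    (by simp; linarith)
  convert this using 3
  ring

lemma ft_L1 (s : ℝ) (hs : 1 < s) (u : E2 → ℂ) (hu : HsNorm s u < ⊤) :
    Integrable (ft u) ∧ ∫ ξ, ‖ft u ξ‖ ≤
      ((∫ ξ : E2, (1 + ‖ξ‖ ^ 2) ^ (-s)) + 1) * (1 + (HsNorm s u).toReal) := by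
  obtain ⟨hJ, hJe⟩ := Hs_integrable s u hu
  have hK := weight_integrable s hs
  set A := (HsNorm s u).toReal with hA
  have hA0 : 0 ≤ A := ENNReal.toReal_nonneg
  set K := ∫ ξ : E2, (1 + ‖ξ‖ ^ 2) ^ (-s) with hKdef
  have hK0 : 0 ≤ K := integral_nonneg fun _ => by positivity
  have hθ : 0 < 1 + A := by linarith
  have hpt : ∀ ξ : E2, ‖ft u ξ‖ ≤ (1 + A) * (1 + ‖ξ‖ ^ 2) ^ (-s) +
      (1 + A)⁻¹ * ((1 + ‖ξ‖ ^ 2) ^ s * ‖ft u ξ‖ ^ 2) := by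
    intro ξ
    have hw : 0 < (1 + ‖ξ‖ ^ 2) ^ s := by positivity
    rw [Real.rpow_neg (by positivity)]
    set w := (1 + ‖ξ‖ ^ 2) ^ s
    set a := ‖ft u ξ‖
    have ha : 0 ≤ a := norm_nonneg _
    have e : (1 + A) * w⁻¹ + (1 + A)⁻¹ * (w * a ^ 2) - 2 * a =
        (1 + A)⁻¹ * w⁻¹ * ((1 + A) - w * a) ^ 2 := by
      field_simp
      ring
    have : 0 ≤ (1 + A)⁻¹ * w⁻¹ * ((1 + A) - w * a) ^ 2 := by positivity
    linarith
  have hI := (hK.const_mul (1 + A)).add (hJ.const_mul (1 + A)⁻¹)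
  have hI' : Integrable (fun ξ : E2 => (1 + A) * (1 + ‖ξ‖ ^ 2) ^ (-s) +
      (1 + A)⁻¹ * ((1 + ‖ξ‖ ^ 2) ^ s * ‖ft u ξ‖ ^ 2)) := hI
  have hIntg : Integrable (ft u) :=
    hI'.mono' (ft_measurable u).aestronglyMeasurable (ae_of_all _ hpt)
  refine ⟨hIntg, ?_⟩
  refine (integral_mono hIntg.norm hI' hpt).trans ?_
  rw [integral_add (hK.const_mul (1 + A)) (hJ.const_mul (1 + A)⁻¹), integral_const_mul,
    integral_const_mul, hJe, ← hKdef]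
  have : (1 + A)⁻¹ * A ^ 2 ≤ 1 + A := by
    rw [inv_mul_le_iff₀ hθ]
    nlinarith
  nlinarith

lemma weight_bounds (s : ℝ) (hs : 1 < s) (u : E2 → ℂ) (ξ : E2) :
    ‖ft u ξ‖ ^ 2 ≤ (1 + ‖ξ‖ ^ 2) ^ s * ‖ft u ξ‖ ^ 2 ∧
    (‖ξ‖ ^ s * ‖ft u ξ‖) ^ 2 ≤ (1 + ‖ξ‖ ^ 2) ^ s * ‖ft u ξ‖ ^ 2 := by
  constructor
  · have : 1 ≤ (1 + ‖ξ‖ ^ 2) ^ s := Real.one_le_rpow (by nlinarith [sq_nonneg ‖ξ‖]) (by linarith)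
    nlinarith [sq_nonneg ‖ft u ξ‖]
  · rw [mul_pow]
    gcongr
    rw [← Real.rpow_natCast (‖ξ‖ ^ s) 2, ← Real.rpow_mul (norm_nonneg _), mul_comm s,
      Real.rpow_mul (norm_nonneg _)]
    have : ‖ξ‖ ^ ((2:ℕ):ℝ) = ‖ξ‖ ^ 2 := Real.rpow_natCast _ _
    rw [this]
    apply Real.rpow_le_rpow (by positivity) (by linarith) (by linarith)

lemma integral_scale (F : E2 → ℝ) (lam : ℝ) (hl : 0 < lam) :
    ∫ ξ, F (lam • ξ) = (lam ^ 2)⁻¹ * ∫ ξ, F ξ := by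
  rw [Measure.integral_comp_smul]
  simp only [finrank_euclideanSpace, Fintype.card_fin, smul_eq_mul]
  rw [abs_of_pos (by positivity)]

/-- Core estimate. -/
lemma core_bound (s : ℝ) (hs₁ : 8/7 < s) (hs₂ : s < 2) (Cd : ℕ → ℝ)
    (lam : ℝ) (hl : 1 ≤ lam) (N : ℝ) (hN : 1 ≤ N) (m : E2 → ℝ) (hm : IsIMult s N Cd m)
    (u₀ : E2 → ℂ) (hu : HsNorm s u₀ < ⊤) :
    energy (mulOp m (fun x => (lam : ℂ)⁻¹ * u₀ (lam⁻¹ • x))) ≤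
      8 * (lam ^ (-(2*s)) * N ^ (2*(2 - s))) * (HsNorm s u₀).toReal ^ 2 +
      lam ^ (-4 : ℝ) * (((∫ ξ : E2, (1 + ‖ξ‖ ^ 2) ^ (-s)) + 1) * (1 + (HsNorm s u₀).toReal)) ^ 4 *
        (HsNorm s u₀).toReal ^ 2 := by
  have hl0 : 0 < lam := by linarith
  have hN0 : 0 < N := by linarith
  have hs : 1 < s := by linarith
  obtain ⟨hJ, hJe⟩ := Hs_integrable s u₀ hu
  obtain ⟨hU1, hU1e⟩ := ft_L1 s hs u₀ hu
  have hUm := ft_measurable u₀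
  have hmc : Continuous m := hm.smooth.continuous
  set A := (HsNorm s u₀).toReal with hA
  set U := ft u₀ with hUdef
  set K1 := ((∫ ξ : E2, (1 + ‖ξ‖ ^ 2) ^ (-s)) + 1) * (1 + A) with hK1
  let h : E2 → ℂ := fun ξ => (m ξ : ℂ) * ((lam : ℂ) * U (lam • ξ))
  have hop : mulOp m (fun x => (lam : ℂ)⁻¹ * u₀ (lam⁻¹ • x)) = invFt h := by
    unfold mulOp
    congr 1
    ext ξ
    rw [ft_scale u₀ lam hl0]
  have hhm : Measurable h := by
    have h1 : Measurable (fun ξ : E2 => U (lam • ξ)) := hUm.comp (measurable_const_smul lam)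
    have h2 : Measurable m := hmc.measurable
    simp only [h]
    fun_prop
  have hnorm : ∀ ξ, ‖h ξ‖ = m ξ * (lam * ‖U (lam • ξ)‖) := by
    intro ξ
    simp only [h, norm_mul, Complex.norm_real, Real.norm_eq_abs, abs_of_pos (hm.pos ξ),
      abs_of_pos hl0]
  have hle : ∀ ξ, ‖h ξ‖ ≤ lam * ‖U (lam • ξ)‖ := by
    intro ξ
    rw [hnorm]
    exact mul_le_of_le_one_left (by positivity) (hm.le_one ξ)
  -- integrability of the L1, L2, weighted pieces
  have hUs1 : Integrable (fun ξ => ‖U (lam • ξ)‖) := (hU1.norm).comp_smul hl0.ne'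
  have hU2 : Integrable (fun ξ => ‖U ξ‖ ^ 2) :=
    hJ.mono' (by fun_prop) (ae_of_all _ fun ξ => by
      rw [Real.norm_of_nonneg (by positivity)]; exact (weight_bounds s hs u₀ ξ).1)
  have hP2 : Integrable (fun ξ => (‖ξ‖ ^ s * ‖U ξ‖) ^ 2) :=
    hJ.mono' (by fun_prop) (ae_of_all _ fun ξ => by
      rw [Real.norm_of_nonneg (by positivity)]; exact (weight_bounds s hs u₀ ξ).2)
  have hU2e : ∫ ξ, ‖U ξ‖ ^ 2 ≤ A ^ 2 := by
    rw [← hJe]; exact integral_mono hU2 hJ fun ξ => (weight_bounds s hs u₀ ξ).1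
  have hP2e : ∫ ξ, (‖ξ‖ ^ s * ‖U ξ‖) ^ 2 ≤ A ^ 2 := by
    rw [← hJe]; exact integral_mono hP2 hJ fun ξ => (weight_bounds s hs u₀ ξ).2
  have hU2s : Integrable (fun ξ => ‖U (lam • ξ)‖ ^ 2) := hU2.comp_smul hl0.ne'
  have hP2s : Integrable (fun ξ => (‖lam • ξ‖ ^ s * ‖U (lam • ξ)‖) ^ 2) := hP2.comp_smul hl0.ne'
  have hh1 : Integrable h :=
    (hUs1.const_mul lam).mono' hhm.aestronglyMeasurable (ae_of_all _ hle)
  have b1 : ∫ ξ, ‖h ξ‖ ≤ lam⁻¹ * K1 := by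
    calc ∫ ξ, ‖h ξ‖ ≤ ∫ ξ, lam * ‖U (lam • ξ)‖ := integral_mono hh1.norm (hUs1.const_mul lam) hle
      _ = lam⁻¹ * ∫ ξ, ‖U ξ‖ := by
        rw [integral_const_mul, integral_scale (fun ξ => ‖U ξ‖) lam hl0]
        field_simp
      _ ≤ _ := by gcongr
  have hle2 : ∀ ξ, ‖h ξ‖ ^ 2 ≤ lam ^ 2 * ‖U (lam • ξ)‖ ^ 2 := by
    intro ξ
    rw [← mul_pow]
    exact pow_le_pow_left₀ (norm_nonneg _) (hle ξ) 2
  have hh2i : Integrable (fun ξ => ‖h ξ‖ ^ 2) :=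
    (hU2s.const_mul (lam ^ 2)).mono' (by fun_prop) (ae_of_all _ fun ξ => by
      rw [Real.norm_of_nonneg (by positivity)]; exact hle2 ξ)
  have hh2 : MemLp h 2 := (memLp_two_iff_integrable_sq_norm hhm.aestronglyMeasurable).2 hh2i
  have b2 : ∫ ξ, ‖h ξ‖ ^ 2 ≤ A ^ 2 := by
    calc ∫ ξ, ‖h ξ‖ ^ 2 ≤ ∫ ξ, lam ^ 2 * ‖U (lam • ξ)‖ ^ 2 :=
          integral_mono hh2i (hU2s.const_mul (lam ^ 2)) hle2
      _ = ∫ ξ, ‖U ξ‖ ^ 2 := by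
        rw [integral_const_mul, integral_scale (fun ξ => ‖U ξ‖ ^ 2) lam hl0]
        field_simp
      _ ≤ _ := hU2e
  let g : E2 → ℂ := fun ξ => ((‖ξ‖ : ℝ) : ℂ) ^ 2 * h ξ
  have hgm : Measurable g := by
    simp only [g]
    fun_prop
  have hgle : ∀ ξ, ‖g ξ‖ ^ 2 ≤ 4 * (lam ^ (-(2*s)) * N ^ (2*(2 - s))) * lam ^ 2 *
      (‖lam • ξ‖ ^ s * ‖U (lam • ξ)‖) ^ 2 := by
    intro ξ
    have e1 : ‖g ξ‖ = (‖ξ‖ ^ 2 * m ξ) * (lam * ‖U (lam • ξ)‖) := by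
      simp only [g]
      rw [norm_mul, hnorm, norm_pow, Complex.norm_real, norm_norm]
      ring
    have e2 : ‖g ξ‖ ≤ (2 * N ^ (2 - s) * ‖ξ‖ ^ s) * (lam * ‖U (lam • ξ)‖) := by
      rw [e1]
      exact mul_le_mul_of_nonneg_right (mult_bound s N hs₁ hs₂ hN Cd m hm ξ) (by positivity)
    refine (pow_le_pow_left₀ (norm_nonneg _) e2 2).trans (le_of_eq ?_)
    rw [norm_smul, Real.norm_of_nonneg hl0.le, Real.mul_rpow hl0.le (norm_nonneg _)]
    have e3 : N ^ (2 * (2 - s)) = (N ^ (2 - s)) ^ 2 := by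
      rw [mul_comm, Real.rpow_mul hN0.le]; exact Real.rpow_natCast _ 2
    have e4 : lam ^ (-(2 * s)) * (lam ^ s) ^ 2 = 1 := by
      have : (lam ^ s) ^ 2 = lam ^ (2 * s) := by
        rw [mul_comm, Real.rpow_mul hl0.le]; exact (Real.rpow_natCast _ 2).symm
      rw [this, ← Real.rpow_add hl0]
      simp
    rw [e3]
    linear_combination (-4 * (N ^ (2 - s)) ^ 2 * lam ^ 2 * (‖ξ‖ ^ s) ^ 2 * ‖U (lam • ξ)‖ ^ 2) * e4
  have hgi : Integrable (fun ξ => ‖g ξ‖ ^ 2) :=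
    (hP2s.const_mul _).mono' (by fun_prop) (ae_of_all _ fun ξ => by
      rw [Real.norm_of_nonneg (by positivity)]; exact hgle ξ)
  have hg2 : MemLp g 2 := (memLp_two_iff_integrable_sq_norm hgm.aestronglyMeasurable).2 hgi
  have b3 : ∫ ξ, ‖g ξ‖ ^ 2 ≤ 4 * (lam ^ (-(2*s)) * N ^ (2*(2 - s))) * A ^ 2 := by
    calc ∫ ξ, ‖g ξ‖ ^ 2 ≤ ∫ ξ, 4 * (lam ^ (-(2*s)) * N ^ (2*(2 - s))) * lam ^ 2 *
          (‖lam • ξ‖ ^ s * ‖U (lam • ξ)‖) ^ 2 := integral_mono hgi (hP2s.const_mul _) hgle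
      _ = 4 * (lam ^ (-(2*s)) * N ^ (2*(2 - s))) * ∫ ξ, (‖ξ‖ ^ s * ‖U ξ‖) ^ 2 := by
        rw [integral_const_mul, integral_scale (fun ξ => (‖ξ‖ ^ s * ‖U ξ‖) ^ 2) lam hl0]
        field_simp
      _ ≤ _ := by gcongr
  rw [hop]
  have main := energy_invFt_le h hh1 hh2 hg2
  have n1 : 0 ≤ ∫ ξ, ‖h ξ‖ := integral_nonneg fun _ => norm_nonneg _
  have n2 : 0 ≤ ∫ ξ, ‖h ξ‖ ^ 2 := integral_nonneg fun _ => by positivity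
  have b4 : (∫ ξ, ‖h ξ‖) ^ 4 * ∫ ξ, ‖h ξ‖ ^ 2 ≤ (lam⁻¹ * K1) ^ 4 * A ^ 2 := by gcongr
  have e5 : lam ^ (-4 : ℝ) = lam⁻¹ ^ 4 := by
    rw [Real.rpow_neg hl0.le, inv_pow]
    congr 1
    exact_mod_cast Real.rpow_natCast lam 4
  rw [e5, ← mul_pow]
  have b3' : ∫ ξ, ‖((‖ξ‖ : ℝ) : ℂ) ^ 2 * h ξ‖ ^ 2 ≤
    4 * (lam ^ (-(2*s)) * N ^ (2*(2 - s))) * A ^ 2 := b3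
  linarith

/-- bound on the modified energy of the rescaled datum. -/
theorem scaled_datum_energy_bound (s : ℝ) (hs₁ : 8/7 < s) (hs₂ : s < 2) (Cd : ℕ → ℝ) :
    ∃ C > (0:ℝ), ∀ lam : ℝ, 1 ≤ lam → ∀ N : ℝ, 1 ≤ N →
      ∀ m : E2 → ℝ, IsIMult s N Cd m →
        ∀ u₀ : E2 → ℂ, HsNorm s u₀ < ⊤ →
          energy (mulOp m (fun x => (lam : ℂ)⁻¹ * u₀ (lam⁻¹ • x))) ≤
            C * (lam ^ (-(2*s)) * N ^ (2*(2 - s)) + lam ^ ((-4 : ℝ))) *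
              (1 + (HsNorm s u₀).toReal) ^ 6 ∧
          energy (mulOp m (fun x => (lam : ℂ)⁻¹ * u₀ (lam⁻¹ • x))) ≤
            C * lam ^ (-(2*s)) * N ^ (2*(2 - s)) * (1 + (HsNorm s u₀).toReal) ^ 6 := by
  set K := ∫ ξ : E2, (1 + ‖ξ‖ ^ 2) ^ (-s) with hK
  have hK0 : 0 ≤ K := integral_nonneg fun _ => by positivity
  refine ⟨2 * (8 + (K + 1) ^ 4), by positivity, ?_⟩
  intro lam hl N hN m hm u₀ hu
  have core := core_bound s hs₁ hs₂ Cd lam hl N hN m hm u₀ hu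
  rw [← hK] at core
  set A := (HsNorm s u₀).toReal with hA
  have hA0 : 0 ≤ A := ENNReal.toReal_nonneg
  set X := lam ^ (-(2*s)) with hX
  set Y := N ^ (2*(2 - s)) with hY
  set Z := lam ^ (-4 : ℝ) with hZ
  have hl0 : 0 < lam := by linarith
  have hX0 : 0 < X := Real.rpow_pos_of_pos hl0 _
  have hZ0 : 0 < Z := Real.rpow_pos_of_pos hl0 _
  have hY1 : 1 ≤ Y := Real.one_le_rpow hN (by linarith)
  have hZX : Z ≤ X := Real.rpow_le_rpow_of_exponent_le hl (by linarith)
  have hZXY : Z ≤ X * Y := hZX.trans (le_mul_of_one_le_right hX0.le hY1)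
  have hXY : 0 < X * Y := by positivity
  have a1 : A ^ 2 ≤ (1 + A) ^ 6 := by
    calc A ^ 2 ≤ (1 + A) ^ 2 := by gcongr; linarith
      _ ≤ (1 + A) ^ 6 := pow_le_pow_right₀ (by linarith) (by norm_num)
  have a2 : (1 + A) ^ 4 * A ^ 2 ≤ (1 + A) ^ 6 := by
    calc (1 + A) ^ 4 * A ^ 2 ≤ (1 + A) ^ 4 * (1 + A) ^ 2 := by gcongr; linarith
      _ = (1 + A) ^ 6 := by ring
  have c1 : 8 * (X * Y) * A ^ 2 ≤ 8 * (X * Y) * (1 + A) ^ 6 := by gcongr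
  have c2 : Z * ((K + 1) * (1 + A)) ^ 4 * A ^ 2 ≤ Z * (K + 1) ^ 4 * (1 + A) ^ 6 := by
    calc Z * ((K + 1) * (1 + A)) ^ 4 * A ^ 2 = Z * (K + 1) ^ 4 * ((1 + A) ^ 4 * A ^ 2) := by ring
      _ ≤ _ := by gcongr
  set D := (1 + A) ^ 6 with hD
  have hD0 : 0 < D := by positivity
  set Q := (K + 1) ^ 4 with hQ
  have hQ0 : 0 < Q := by positivity
  have d1 : 0 < X * Y * D := by positivity
  have d2 : 0 < Z * D := by positivity
  have d3 : 0 < Q * (X * Y * D) := by positivity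
  have d4 : 0 < Q * (Z * D) := by positivity
  have d5 : Q * (Z * D) ≤ Q * (X * Y * D) := by gcongr
  constructor
  · linarith
  · linarith
end
end
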